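/- Let A and B be p×p complex Hermitian matrices, and let γ_1 ≥ ... ≥ γ_{2p} be the combined list of the eigenvalues of A and of B (with multiplicities), arranged in weakly decreasing order. Then there exist p×p complex Hermitian matrices Ã and B̃ with eigenvalues γ_1, γ_3, ..., γ_{2p−1} (of Ã) and γ_2, γ_4, ..., γ_{2p} (of B̃), such that à + B̃ = A + B. -/

import Mathlib

/-- `M` is a Hermitian matrix whose eigenvalues, with multiplicity, are `{μ i : i}`. -/
def HasEigs {ι : Type} [Fintype ι] [DecidableEq ι] (M : Matrix ι ι ℂ) (μ : ι → ℝ) : Prop :=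
  ∃ U : Matrix ι ι ℂ, U * U.conjTranspose = 1 ∧ U.conjTranspose * U = 1 ∧
    M = U * Matrix.diagonal (fun i => (μ i : ℂ)) * U.conjTranspose

/-- `X` has singular values `s 1 ≥ s 2 ≥ ... ≥ s q ≥ 0` where `q = min(#rows, #cols)`:
`s` is weakly decreasing and nonnegative on `1..q`, and the eigenvalues of `Xᴴ * X`
are `s 1 ^ 2, ..., s q ^ 2` together with `#cols - q` zeros. -/
def HasSVals {ι κ : Type} [Fintype ι] [Fintype κ] [DecidableEq κ]
    (X : Matrix ι κ ℂ) (q : ℕ) (s : ℕ → ℝ) : Prop :=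
  q = min (Fintype.card ι) (Fintype.card κ) ∧
  (∀ a b, 1 ≤ a → a ≤ b → b ≤ q → s b ≤ s a) ∧
  (∀ a, 1 ≤ a → a ≤ q → 0 ≤ s a) ∧
  ∃ e : κ ≃ Fin (Fintype.card κ),
    HasEigs (X.conjTranspose * X)
      (fun j => if (e j : ℕ) + 1 ≤ q then s ((e j : ℕ) + 1) ^ 2 else 0)

section

open MeasureTheory Matrix

/-- The unitary group `U(p)`. -/
abbrev UGrp (p : ℕ) : Type := Matrix.unitaryGroup (Fin p) ℂ

instance (p : ℕ) : CompactSpace (UGrp p) := by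
  apply isCompact_iff_compactSpace.mp
  have hK : IsCompact (Set.pi Set.univ (fun _ : Fin p => Set.pi Set.univ
      (fun _ : Fin p => Metric.closedBall (0 : ℂ) 1))) :=
    isCompact_univ_pi fun _ => isCompact_univ_pi fun _ => isCompact_closedBall 0 1
  have hcl : IsClosed ((Matrix.unitaryGroup (Fin p) ℂ : Submonoid _) :
      Set (Matrix (Fin p) (Fin p) ℂ)) := by
    have : ((Matrix.unitaryGroup (Fin p) ℂ : Submonoid _) : Set (Matrix (Fin p) (Fin p) ℂ))
        = {U | star U * U = 1 ∧ U * star U = 1} := by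
      ext U; exact Unitary.mem_iff
    rw [this]
    exact (isClosed_eq (by fun_prop) continuous_const).inter
      (isClosed_eq (by fun_prop) continuous_const)
  refine IsCompact.of_isClosed_subset hK hcl ?_
  intro U hU i _ j _
  simpa using entry_norm_bound_of_unitary hU i j

noncomputable instance (p : ℕ) : MeasurableSpace (UGrp p) := borel _
instance (p : ℕ) : BorelSpace (UGrp p) := ⟨rfl⟩

/-- Normalised Haar measure on `U(p)`. -/
noncomputable def haarU (p : ℕ) : Measure (UGrp p) := Measure.haarMeasure ⊤

instance (p : ℕ) : (haarU p).IsHaarMeasure := by unfold haarU; infer_instance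
instance (p : ℕ) : IsProbabilityMeasure (haarU p) :=
  ⟨by unfold haarU; simpa using
    Measure.haarMeasure_self (K₀ := (⊤ : TopologicalSpace.PositiveCompacts (UGrp p)))⟩

/-- `U⋆ Y U`. -/
noncomputable def cnj {p : ℕ} (U : UGrp p) (Y : Matrix (Fin p) (Fin p) ℂ) :
    Matrix (Fin p) (Fin p) ℂ := star (U : Matrix (Fin p) (Fin p) ℂ) * Y * U

/-- The integral of the character `exp (i L)` over the unitary orbit of `Y`. -/
noncomputable def orb {p : ℕ} (L : Matrix (Fin p) (Fin p) ℂ →+ ℝ)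
    (Y : Matrix (Fin p) (Fin p) ℂ) : ℂ :=
  ∫ U, Complex.exp (L (cnj U Y) * Complex.I) ∂(haarU p)

section orb
variable {p : ℕ} {L : Matrix (Fin p) (Fin p) ℂ →+ ℝ}

lemma Continuous.cnj {α : Type*} [TopologicalSpace α] {f : α → UGrp p}
    {g : α → Matrix (Fin p) (Fin p) ℂ} (hf : Continuous f) (hg : Continuous g) :
    Continuous fun x => cnj (f x) (g x) := by
  have h : Continuous fun x => (f x : Matrix (Fin p) (Fin p) ℂ) :=
    continuous_subtype_val.comp hf
  exact (h.star.mul hg).mul h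

lemma continuous_orbKernel {α : Type*} [TopologicalSpace α] (hL : Continuous L)
    {f : α → UGrp p} {g : α → Matrix (Fin p) (Fin p) ℂ}
    (hf : Continuous f) (hg : Continuous g) :
    Continuous fun x => Complex.exp (L (cnj (f x) (g x)) * Complex.I) :=
  Complex.continuous_exp.comp
    ((Complex.continuous_ofReal.comp (hL.comp (hf.cnj hg))).mul continuous_const)

lemma norm_orb_le (Y : Matrix (Fin p) (Fin p) ℂ) : ‖orb L Y‖ ≤ 1 := by
  refine (norm_integral_le_of_norm_le_const (C := 1) ?_).trans (by simp)
  exact .of_forall fun U => (Complex.norm_exp_ofReal_mul_I _).le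

lemma orb_cnj (W : UGrp p) (Y : Matrix (Fin p) (Fin p) ℂ) : orb L (cnj W Y) = orb L Y := by
  have := integral_mul_left_eq_self (μ := haarU p)
    (fun U => Complex.exp (L (cnj U Y) * Complex.I)) W
  rw [orb, orb, ← this]
  congr 1
  ext U
  simp [cnj, Matrix.mul_assoc]

lemma continuous_orb (hL : Continuous L) : Continuous (orb L) := by
  have : FirstCountableTopology (Matrix (Fin p) (Fin p) ℂ) :=
    inferInstanceAs (FirstCountableTopology (Fin p → Fin p → ℂ))
  refine continuous_of_dominated (bound := fun _ => 1)
    (fun Y => (continuous_orbKernel hL continuous_id continuous_const).aestronglyMeasurable)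
    (fun Y => .of_forall fun U => (Complex.norm_exp_ofReal_mul_I _).le)
    (integrable_const _)
    (.of_forall fun U => continuous_orbKernel hL continuous_const continuous_id)

end orb

section gaussian
variable {p : ℕ} {L : Matrix (Fin p) (Fin p) ℂ →+ ℝ}

lemma sum_normSq_mulVec (U : UGrp p) (v : Fin p → ℂ) :
    ∑ a, Complex.normSq ((star (U : Matrix (Fin p) (Fin p) ℂ) *ᵥ v) a) =
      ∑ a, Complex.normSq (v a) := by
  have key (w : Fin p → ℂ) : ((∑ a, Complex.normSq (w a) : ℝ) : ℂ) = star w ⬝ᵥ w := by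
    simp [dotProduct, Complex.normSq_eq_conj_mul_self]
  apply Complex.ofReal_injective
  rw [key, key, star_mulVec, dotProduct_mulVec, vecMul_vecMul, star_eq_conjTranspose,
    conjTranspose_conjTranspose, ← star_eq_conjTranspose,
    Unitary.mul_star_self_of_mem U.2, vecMul_one]

lemma measurePreserving_mulVec (U : UGrp p) :
    MeasurePreserving (fun v : Fin p → ℂ => star (U : Matrix (Fin p) (Fin p) ℂ) *ᵥ v) := by
  set f : (Fin p → ℂ) →ₗ[ℝ] (Fin p → ℂ) :=
    (Matrix.mulVecLin (star (U : Matrix (Fin p) (Fin p) ℂ))).restrictScalars ℝ with hf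
  set g : (Fin p → ℂ) →ₗ[ℝ] (Fin p → ℂ) :=
    (Matrix.mulVecLin (U : Matrix (Fin p) (Fin p) ℂ)).restrictScalars ℝ with hg
  have hfg : f * g = 1 := by
    refine LinearMap.ext fun v => ?_
    simp [hf, hg, Unitary.star_mul_self_of_mem U.2]
  have hdet : LinearMap.det f ≠ 0 := by
    intro h
    have := congrArg LinearMap.det hfg
    simp [h] at this
  have hmap := Measure.map_linearMap_addHaar_eq_smul_addHaar (volume : Measure (Fin p → ℂ)) hdet
  have hfc : Continuous f := f.continuous_of_finiteDimensional
  set B : Set (Fin p → ℂ) := {v | ∑ a, Complex.normSq (v a) < 1} with hB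
  have hBo : IsOpen B := isOpen_lt (by fun_prop) continuous_const
  have hpre : f ⁻¹' B = B := by
    ext v
    simp only [hB, Set.mem_preimage, Set.mem_ofPred_eq, hf, LinearMap.restrictScalars_apply,
      Matrix.mulVecLin_apply, sum_normSq_mulVec]
  have hpos : volume B ≠ 0 := by
    apply (hBo.measure_pos volume ⟨0, by simp [hB]⟩).ne'
  have hfin : volume B ≠ ⊤ := by
    refine ((measure_mono (t := Metric.closedBall 0 1) ?_).trans_lt
      measure_closedBall_lt_top).ne
    intro v hv
    rw [mem_closedBall_zero_iff, pi_norm_le_iff_of_nonneg zero_le_one]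
    intro a
    have : Complex.normSq (v a) ≤ 1 :=
      (Finset.single_le_sum (fun i _ => Complex.normSq_nonneg (v i)) (Finset.mem_univ a)).trans
        (le_of_lt hv)
    rw [Complex.normSq_eq_norm_sq] at this
    nlinarith [norm_nonneg (v a)]
  have h1 := congrArg (fun m => m B) hmap
  simp only [Measure.map_apply hfc.measurable hBo.measurableSet, hpre, Measure.smul_apply,
    smul_eq_mul] at h1
  have h2 : ENNReal.ofReal |(LinearMap.det f)⁻¹| = 1 := by
    rw [eq_comm, ← ENNReal.mul_left_inj hpos hfin, one_mul]; exact h1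
  refine ⟨hfc.measurable, ?_⟩
  rw [h2, one_smul] at hmap
  exact hmap

lemma integrable_gauss {θ : ℂ} (hθ : 0 < θ.re) :
    Integrable fun v : Fin p → ℂ => Complex.exp (-θ * ∑ a, (Complex.normSq (v a) : ℂ)) := by
  have h1 : Integrable fun z : ℂ => Complex.exp (-θ * (Complex.normSq z : ℂ)) := by
    have := GaussianFourier.integrable_cexp_neg_mul_sq_norm_add (V := ℂ) hθ 0 0
    simpa [Complex.normSq_eq_norm_sq] using this
  have := Integrable.fintype_prod (ι := Fin p) (fun _ => h1)
  simpa only [Finset.mul_sum, Complex.exp_sum, volume_pi] using this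

/-- The Gaussian average of `exp (i L)` over rank one matrices. -/
noncomputable def gaussK (L : Matrix (Fin p) (Fin p) ℂ →+ ℝ) (θ : ℂ) : ℂ :=
  ∫ v : Fin p → ℂ, Complex.exp (L (vecMulVec v (star v)) * Complex.I) *
    Complex.exp (-θ * ∑ a, (Complex.normSq (v a) : ℂ))

lemma cnj_vecMulVec (U : UGrp p) (v : Fin p → ℂ) :
    cnj U (vecMulVec v (star v)) =
      vecMulVec (star (U : Matrix (Fin p) (Fin p) ℂ) *ᵥ v)
        (star (star (U : Matrix (Fin p) (Fin p) ℂ) *ᵥ v)) := by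
  rw [cnj, mul_vecMulVec, vecMulVec_mul, star_mulVec, star_eq_conjTranspose,
    conjTranspose_conjTranspose]

lemma continuous_vecMulVec_star :
    Continuous fun v : Fin p → ℂ => vecMulVec v (star v) :=
  continuous_id.matrix_vecMulVec continuous_star

lemma integral_orb_rankOne (hL : Continuous L) (Y : Matrix (Fin p) (Fin p) ℂ) {θ : ℂ}
    (hθ : 0 < θ.re) :
    ∫ v : Fin p → ℂ, orb L (Y + vecMulVec v (star v)) *
      Complex.exp (-θ * ∑ a, (Complex.normSq (v a) : ℂ)) = gaussK L θ * orb L Y := by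
  have hadd (U : UGrp p) (v : Fin p → ℂ) : cnj U (Y + vecMulVec v (star v)) =
      cnj U Y + cnj U (vecMulVec v (star v)) := by
    simp [cnj, Matrix.mul_add, Matrix.add_mul]
  have hint : Integrable (Function.uncurry fun (v : Fin p → ℂ) (U : UGrp p) =>
      Complex.exp (L (cnj U (Y + vecMulVec v (star v))) * Complex.I) *
        Complex.exp (-θ * ∑ a, (Complex.normSq (v a) : ℂ)))
      ((volume : Measure (Fin p → ℂ)).prod (haarU p)) := by
    have h1 := (integrable_gauss (p := p) hθ).mul_prod (integrable_const (1 : ℂ) (μ := haarU p))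
    refine h1.mono ?_ ?_
    · apply Continuous.aestronglyMeasurable
      apply Continuous.mul
      · exact continuous_orbKernel hL continuous_snd
          (continuous_const.add (continuous_vecMulVec_star.comp continuous_fst))
      · fun_prop
    · refine .of_forall fun q => ?_
      simp only [Function.uncurry, norm_mul, Complex.norm_exp_ofReal_mul_I]
      simp
  simp_rw [orb, ← integral_mul_const]
  rw [integral_integral_swap hint, ← integral_const_mul]
  congr 1
  ext U
  simp_rw [hadd, map_add, Complex.ofReal_add, add_mul, Complex.exp_add, mul_assoc]
  rw [integral_const_mul, mul_comm (gaussK L θ)]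
  congr 1
  have hmp := measurePreserving_mulVec U
  have hc : Continuous fun v : Fin p → ℂ => Complex.exp (L (vecMulVec v (star v)) * Complex.I) *
      Complex.exp (-θ * ∑ a, (Complex.normSq (v a) : ℂ)) := by
    have := hL.comp (continuous_vecMulVec_star (p := p))
    simp only [Function.comp_def] at this
    fun_prop
  rw [gaussK]
  conv_rhs => rw [← hmp.map_eq]
  rw [integral_map hmp.measurable.aemeasurable hc.aestronglyMeasurable]
  congr 1
  ext v
  rw [cnj_vecMulVec]
  congr 3
  exact_mod_cast (sum_normSq_mulVec U v).symm

end gaussian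

lemma map_normSq_volume : Measure.map (fun z : ℂ => Complex.normSq z) volume =
    (NNReal.pi : ENNReal) • (volume.restrict (Set.Ioi (0 : ℝ))) := by
  symm
  have hc : Measurable fun z : ℂ => Complex.normSq z := Complex.continuous_normSq.measurable
  have hball (x : ℝ) : (fun z : ℂ => Complex.normSq z) ⁻¹' Set.Iic x =
      if 0 ≤ x then Metric.closedBall 0 √x else ∅ := by
    ext z
    split_ifs with h
    · simp [Complex.normSq_eq_norm_sq, Real.le_sqrt (norm_nonneg z) h]
    · simp; linarith [Complex.normSq_nonneg z]
  have hvol (x : ℝ) : volume ((fun z : ℂ => Complex.normSq z) ⁻¹' Set.Iic x) =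
      ENNReal.ofReal x * NNReal.pi := by
    rw [hball]
    split_ifs with h
    · rw [Complex.volume_closedBall, ← ENNReal.ofReal_pow (Real.sqrt_nonneg _), Real.sq_sqrt h]
    · rw [ENNReal.ofReal_of_nonpos (by linarith)]; simp
  have : IsLocallyFiniteMeasure ((NNReal.pi : ENNReal) • (volume.restrict (Set.Ioi (0 : ℝ)))) := by
    rw [← ENNReal.smul_def]; infer_instance
  refine Measure.ext_of_Ioc _ _ fun a b hab => ?_
  rw [Measure.map_apply hc measurableSet_Ioc, Measure.smul_apply, smul_eq_mul,
    Measure.restrict_apply measurableSet_Ioc, ← Set.Iic_sdiff_Iic, Set.preimage_sdiff,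
    measure_sdiff (Set.preimage_mono (Set.Iic_subset_Iic.2 hab.le))
      (hc measurableSet_Iic).nullMeasurableSet (by rw [hvol]; finiteness), hvol, hvol,
      Set.Iic_sdiff_Iic]
  have : Set.Ioc a b ∩ Set.Ioi 0 = Set.Ioc (max a 0) b := by
    ext x; simp
  rw [this, Real.volume_Ioc, mul_comm, ← ENNReal.sub_mul (by finiteness)]
  congr 1
  rcases le_total a 0 with h | h
  · rw [max_eq_right h, ENNReal.ofReal_of_nonpos h]; simp
  · rw [max_eq_left h, ENNReal.ofReal_sub _ h]

/-- The open positive orthant. -/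
def orthant (ι : Type*) : Set (ι → ℝ) := Set.univ.pi fun _ => Set.Ioi 0

lemma integral_normSq_pi {p : ℕ} (ψ : (Fin p → ℝ) → ℂ) (hψ : Measurable ψ) :
    ∫ v : Fin p → ℂ, ψ (fun a => Complex.normSq (v a)) =
      (Real.pi : ℂ) ^ p * ∫ s in orthant (Fin p), ψ s := by
  have hc : Measurable fun z : ℂ => Complex.normSq z := Complex.continuous_normSq.measurable
  have : SigmaFinite (Measure.map (fun z : ℂ => Complex.normSq z) volume) := by
    rw [map_normSq_volume, ← ENNReal.smul_def]; infer_instance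
  have h1 := Measure.pi_map_pi (ι := Fin p) (μ := fun _ => (volume : Measure ℂ))
    (f := fun _ z => Complex.normSq z) (fun _ => hc.aemeasurable)
  have hm : Measurable fun (v : Fin p → ℂ) (a : Fin p) => Complex.normSq (v a) := by fun_prop
  rw [← integral_map (μ := volume) (f := ψ) hm.aemeasurable hψ.aestronglyMeasurable, volume_pi,
    h1, map_normSq_volume]
  have h2 : (Measure.pi fun _ : Fin p =>
      (NNReal.pi : ENNReal) • (volume.restrict (Set.Ioi (0 : ℝ))))
      = (NNReal.pi : ENNReal) ^ p • (volume.restrict (orthant (Fin p))) := by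
    rw [orthant, volume_pi, Measure.restrict_pi_pi]
    have : SigmaFinite ((NNReal.pi : ENNReal) • (volume.restrict (Set.Ioi (0 : ℝ)))) := by
      rw [← ENNReal.smul_def]; infer_instance
    refine (Measure.pi_eq fun s hs => ?_)
    simp [Measure.pi_pi, Finset.prod_mul_distrib]
  rw [h2, integral_smul_measure]
  simp

/-- `√s √sᵀ`. -/
noncomputable def rankOne {p : ℕ} (s : Fin p → ℝ) : Matrix (Fin p) (Fin p) ℂ :=
  vecMulVec (fun a => (√(s a) : ℂ)) (fun a => (√(s a) : ℂ))

/-- Real diagonal matrices. -/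
noncomputable def rdiag {p : ℕ} (y : Fin p → ℝ) : Matrix (Fin p) (Fin p) ℂ :=
  diagonal fun a => (y a : ℂ)

lemma continuous_rdiag {p : ℕ} : Continuous (rdiag (p := p)) := by
  unfold rdiag; fun_prop

lemma continuous_rankOne {p : ℕ} : Continuous (rankOne (p := p)) := by
  unfold rankOne
  exact Continuous.matrix_vecMulVec (by fun_prop) (by fun_prop)

section
variable {p : ℕ} {L : Matrix (Fin p) (Fin p) ℂ →+ ℝ}

lemma orb_rankOne_normSq (y : Fin p → ℝ) (v : Fin p → ℂ) :
    orb L (rdiag y + vecMulVec v (star v)) =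
      orb L (rdiag y + rankOne fun a => Complex.normSq (v a)) := by
  set w : Fin p → ℂ := fun a => if v a = 0 then 1 else (starRingEnd ℂ) (v a) / ‖v a‖ with hw
  have hw1 (a : Fin p) : (starRingEnd ℂ) (w a) * w a = 1 := by
    simp only [hw]
    split_ifs with h
    · simp
    · have : (‖v a‖ : ℂ) ≠ 0 := by simpa using h
      simp only [map_div₀, Complex.conj_conj, Complex.conj_ofReal]
      rw [div_mul_div_comm, Complex.mul_conj, Complex.normSq_eq_norm_sq]
      push_cast
      field_simp
  have hw2 (a : Fin p) : w a * v a = ‖v a‖ := by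
    simp only [hw]
    split_ifs with h
    · simp [h]
    · have : (‖v a‖ : ℂ) ≠ 0 := by simpa using h
      rw [div_mul_eq_mul_div, mul_comm, Complex.mul_conj, Complex.normSq_eq_norm_sq]
      push_cast
      field_simp
  have hW : diagonal (star w) ∈ Matrix.unitaryGroup (Fin p) ℂ := by
    rw [Matrix.mem_unitaryGroup_iff, star_eq_conjTranspose, diagonal_conjTranspose, star_star,
      diagonal_mul_diagonal]
    rw [← diagonal_one]
    congr 1
    ext a
    exact hw1 a
  rw [← orb_cnj ⟨_, hW⟩]
  congr 1
  have hs (a : Fin p) : (√(Complex.normSq (v a)) : ℂ) = ‖v a‖ := by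
    rw [Complex.normSq_eq_norm_sq, Real.sqrt_sq (norm_nonneg _)]
  have hw3 (a : Fin p) : (starRingEnd ℂ) (v a) * (starRingEnd ℂ) (w a) = ‖v a‖ := by
    rw [← map_mul, mul_comm, hw2, Complex.conj_ofReal]
  ext i j
  simp only [cnj, rdiag, rankOne, star_eq_conjTranspose, diagonal_conjTranspose, star_star,
    mul_diagonal, diagonal_mul, Matrix.add_apply, vecMulVec_apply, hs, Pi.star_apply,
    RCLike.star_def]
  rw [← hw2 i, ← hw3 j, mul_add, add_mul]
  congr 1
  · rcases eq_or_ne i j with rfl | h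
    · rw [diagonal_apply_eq, mul_right_comm, mul_comm (w i), hw1, one_mul]
    · simp [h]
  · ring

/-- The normalised Gaussian factor. -/
noncomputable def kap (L : Matrix (Fin p) (Fin p) ℂ →+ ℝ) (θ : ℂ) : ℂ :=
  gaussK L θ / (Real.pi : ℂ) ^ p

lemma integral_orb_rankOne_orthant (hL : Continuous L) (y : Fin p → ℝ) {θ : ℂ}
    (hθ : 0 < θ.re) :
    ∫ s in orthant (Fin p), orb L (rdiag y + rankOne s) * Complex.exp (-θ * ∑ a, (s a : ℂ)) =
      kap L θ * orb L (rdiag y) := by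
  have h1 := integral_orb_rankOne hL (rdiag y) hθ
  have h2 := integral_normSq_pi
    (fun s => orb L (rdiag y + rankOne s) * Complex.exp (-θ * ∑ a, (s a : ℂ))) (by
      apply Continuous.measurable
      exact ((continuous_orb hL).comp (continuous_const.add continuous_rankOne)).mul
        (by fun_prop))
  simp only [orb_rankOne_normSq] at h1
  have hpi : (Real.pi : ℂ) ^ p ≠ 0 := by simp [Real.pi_ne_zero]
  rw [kap, div_mul_eq_mul_div, ← h1, h2, mul_div_cancel_left₀ _ hpi]

end

lemma exists_perm_of_multiset_map_eq {ι α : Type*} [Fintype ι] [DecidableEq α] {f g : ι → α}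
    (h : Finset.univ.val.map f = Finset.univ.val.map g) : ∃ σ : Equiv.Perm ι, f = g ∘ σ := by
  classical
  have hc (c : α) : Nonempty ({a // f a = c} ≃ {a // g a = c}) := by
    rw [← Fintype.card_eq, Fintype.card_subtype, Fintype.card_subtype]
    have := congrArg (Multiset.count c) h
    simpa [Multiset.count_map, Finset.card, Finset.filter, eq_comm] using this
  refine ⟨Equiv.ofFiberEquiv fun c => (hc c).some, ?_⟩
  ext a
  exact (Equiv.ofFiberEquiv_map _ a).symm

lemma exists_perm_of_prod_X_sub_C_eq {ι : Type*} [Fintype ι] {f g : ι → ℝ}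
    (h : ∏ i, (Polynomial.X - Polynomial.C (f i : ℂ)) =
      ∏ i, (Polynomial.X - Polynomial.C (g i : ℂ))) : ∃ σ : Equiv.Perm ι, f = g ∘ σ := by
  have hr (k : ι → ℝ) : (∏ i, (Polynomial.X - Polynomial.C (k i : ℂ))).roots =
      Finset.univ.val.map fun i => (k i : ℂ) := by
    have := Polynomial.roots_multiset_prod_X_sub_C (Finset.univ.val.map fun i => (k i : ℂ))
    rwa [Multiset.map_map] at this
  classical
  obtain ⟨σ, hσ⟩ := exists_perm_of_multiset_map_eq ((hr f).symm.trans ((congrArg _ h).trans (hr g)))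
  refine ⟨σ, ?_⟩
  ext i
  simpa using congrFun hσ i

section
variable {p : ℕ}

lemma cnj_mul (U W : UGrp p) (Y : Matrix (Fin p) (Fin p) ℂ) :
    cnj (U * W) Y = cnj W (cnj U Y) := by
  simp [cnj, Matrix.mul_assoc]

lemma exists_cnj_rdiag_comp (y : Fin p → ℝ) (σ : Equiv.Perm (Fin p)) :
    ∃ W : UGrp p, rdiag (y ∘ σ) = cnj W (rdiag y) := by
  have hW : (1 : Matrix (Fin p) (Fin p) ℂ).submatrix id σ ∈ Matrix.unitaryGroup (Fin p) ℂ := by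
    rw [Matrix.mem_unitaryGroup_iff', star_eq_conjTranspose, conjTranspose_submatrix,
      conjTranspose_one, ← Matrix.submatrix_mul _ _ _ _ _ Function.bijective_id, one_mul,
      submatrix_one_equiv]
  refine ⟨⟨_, hW⟩, ?_⟩
  have h1 : rdiag (y ∘ σ) = (rdiag y).submatrix σ σ := by
    ext i j
    simp [rdiag, diagonal_apply]
  rw [h1, cnj, star_eq_conjTranspose, conjTranspose_submatrix, conjTranspose_one]
  ext i j
  simp [Matrix.mul_apply, Matrix.one_apply]

lemma exists_cnj_of_charpoly {M : Matrix (Fin p) (Fin p) ℂ} (hM : M.IsHermitian) {y : Fin p → ℝ}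
    (h : M.charpoly = ∏ i, (Polynomial.X - Polynomial.C (y i : ℂ))) :
    ∃ W : UGrp p, M = cnj W (rdiag y) := by
  rw [hM.charpoly_eq] at h
  obtain ⟨σ, hσ⟩ := exists_perm_of_prod_X_sub_C_eq h
  obtain ⟨W, hW⟩ := exists_cnj_rdiag_comp y σ
  refine ⟨W * star hM.eigenvectorUnitary, ?_⟩
  rw [cnj_mul, ← hW, ← hσ]
  conv_lhs => rw [hM.spectral_theorem, Unitary.conjStarAlgAut_apply]
  simp [cnj, rdiag, Function.comp_def]

lemma charpoly_eq_of_eval {M : Matrix (Fin p) (Fin p) ℂ} {y : Fin p → ℂ}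
    (hy : Function.Injective y) (h : ∀ b, M.charpoly.eval (y b) = 0) :
    M.charpoly = ∏ i, (Polynomial.X - Polynomial.C (y i)) := by
  have hm : (∏ i, (Polynomial.X - Polynomial.C (y i))).Monic :=
    Polynomial.monic_prod_of_monic _ _ fun i _ => Polynomial.monic_X_sub_C _
  have hd : (∏ i, (Polynomial.X - Polynomial.C (y i))).degree = (p : WithBot ℕ) := by
    simp [Polynomial.degree_prod]
  refine Polynomial.eq_of_degree_sub_lt_of_eval_index_eq Finset.univ hy.injOn ?_ ?_
  · have := Polynomial.degree_sub_lt_left (p := M.charpoly)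
      (q := ∏ i, (Polynomial.X - Polynomial.C (y i)))
      (by rw [hd, Matrix.charpoly_degree_eq_dim]; simp) M.charpoly_monic.ne_zero
      (by rw [hm.leadingCoeff, M.charpoly_monic.leadingCoeff])
    simpa [Matrix.charpoly_degree_eq_dim] using this
  · intro i _
    rw [h, Polynomial.eval_prod, Finset.prod_eq_zero (Finset.mem_univ i)]
    simp

lemma trace_cnj (W : UGrp p) (Y : Matrix (Fin p) (Fin p) ℂ) : (cnj W Y).trace = Y.trace := by
  rw [cnj, Matrix.trace_mul_cycle, Unitary.mul_star_self_of_mem W.2, one_mul]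

/-- A rank one perturbation of a diagonal matrix whose secular equation has the roots `y`. -/
lemma exists_cnj_rankOne {l s y : Fin p → ℝ} (hs : ∀ a, 0 < s a) (hy : Function.Injective y)
    (hly : ∀ a b, y b ≠ l a) (h : ∀ b, ∑ c, s c / (y b - l c) = 1) :
    ∃ W : UGrp p, rdiag l + rankOne s = cnj W (rdiag y) := by
  have hsq (a : Fin p) : (√(s a) : ℂ) * √(s a) = s a := by
    rw [← Complex.ofReal_mul, Real.mul_self_sqrt (hs a).le]
  apply exists_cnj_of_charpoly
  · ext i j
    simp only [rdiag, rankOne, conjTranspose_apply, Matrix.add_apply, vecMulVec_apply,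
      diagonal_apply, eq_comm (a := j)]
    split_ifs with hij
    · subst hij; simp
    · simp [mul_comm]
  · refine charpoly_eq_of_eval (y := fun b => (y b : ℂ)) (fun a b hab => hy (by simpa using hab)) ?_
    intro b
    rw [Matrix.eval_charpoly, ← Matrix.exists_mulVec_eq_zero_iff]
    have hp : Nonempty (Fin p) := ⟨b⟩
    have hne (a : Fin p) : (y b : ℂ) - l a ≠ 0 := by
      rw [sub_ne_zero]; exact_mod_cast hly a b
    refine ⟨fun a => (√(s a) : ℂ) / (y b - l a), ?_, ?_⟩
    · intro h0
      have := congrFun h0 b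
      simp only [Pi.zero_apply, div_eq_zero_iff, hne b, or_false, Complex.ofReal_eq_zero] at this
      exact (Real.sqrt_pos.2 (hs b)).ne' this
    · have hd : (fun a => (√(s a) : ℂ)) ⬝ᵥ (fun a => (√(s a) : ℂ) / (y b - l a)) = 1 := by
        rw [dotProduct]
        simp_rw [← mul_div_assoc, hsq]
        exact_mod_cast h b
      ext a
      rw [Matrix.sub_mulVec, Matrix.add_mulVec, rankOne, vecMulVec_mulVec, hd, rdiag]
      simp only [Pi.sub_apply, Pi.add_apply, mulVec_diagonal, Matrix.scalar_apply,
        Pi.zero_apply, MulOpposite.op_one, one_smul]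
      field_simp [hne a]
      ring

end

section
variable {p : ℕ}

/-- The Vandermonde determinant. -/
noncomputable def vand {R : Type*} [CommRing R] (y : Fin p → R) : R := (vandermonde y).det

lemma vand_eq {R : Type*} [CommRing R] (y : Fin p → R) :
    vand y = ∏ i, ∏ j ∈ Finset.Ioi i, (y j - y i) := det_vandermonde y

lemma prod_erase_sub (y : Fin p → ℝ) :
    |∏ b, ∏ c ∈ Finset.univ.erase b, (y b - y c)| = vand y ^ 2 := by
  have h := Finset.prod_prod_Ioi_mul_eq_prod_prod_off_diag (fun i j : Fin p => |y j - y i|)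
  simp_rw [Finset.compl_singleton] at h
  rw [vand_eq, Finset.abs_prod, ← sq_abs]
  simp_rw [Finset.abs_prod]
  calc _ = ∏ b, ∏ c ∈ Finset.univ.erase b, |y b - y c| := by rfl
    _ = _ := by
      rw [← h]
      simp_rw [Finset.prod_mul_distrib, sq, abs_sub_comm]

lemma vand_mul_pos {l y : Fin p → ℝ} (hl : StrictAnti l) (hy : StrictAnti y) :
    0 < vand y * vand l := by
  rw [vand_eq, vand_eq, ← Finset.prod_mul_distrib]
  refine Finset.prod_pos fun i _ => ?_
  rw [← Finset.prod_mul_distrib]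
  refine Finset.prod_pos fun j hj => ?_
  rw [Finset.mem_Ioi] at hj
  exact mul_pos_of_neg_of_neg (sub_neg.2 (hy hj)) (sub_neg.2 (hl hj))

/-- The matrix of the values `∏ c ≠ b, (l a - y c)`. -/
noncomputable def lagMat (l y : Fin p → ℝ) : Matrix (Fin p) (Fin p) ℝ :=
  of fun a b => ∏ c ∈ Finset.univ.erase b, (l a - y c)

lemma abs_det_lagMat {l y : Fin p → ℝ} (hy : vand y ≠ 0) :
    |(lagMat l y).det| = |vand l| * |vand y| := by
  set K : Matrix (Fin p) (Fin p) ℝ := of fun j b =>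
    (∏ c ∈ Finset.univ.erase b, (Polynomial.X - Polynomial.C (y c))).coeff j with hK
  have key (x : Fin p → ℝ) : lagMat x y = vandermonde x * K := by
    ext a b
    have hd : (∏ c ∈ Finset.univ.erase b, (Polynomial.X - Polynomial.C (y c))).natDegree < p := by
      rw [Polynomial.natDegree_prod_of_monic _ _ fun i _ => Polynomial.monic_X_sub_C _]
      simp only [Polynomial.natDegree_X_sub_C, Finset.sum_const, smul_eq_mul, mul_one,
        Finset.card_erase_of_mem (Finset.mem_univ b), Finset.card_univ, Fintype.card_fin]
      have := b.2
      omega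
    have := Polynomial.eval_eq_sum_range' hd (x a)
    rw [Polynomial.eval_prod] at this
    simp only [Polynomial.eval_sub, Polynomial.eval_X, Polynomial.eval_C] at this
    rw [lagMat, of_apply, this, Finset.sum_range, Matrix.mul_apply]
    simp [hK, mul_comm, vandermonde_apply]
  have h1 : |(lagMat y y).det| = vand y ^ 2 := by
    rw [← prod_erase_sub]
    have : lagMat y y = diagonal fun b => ∏ c ∈ Finset.univ.erase b, (y b - y c) := by
      ext a b
      rcases eq_or_ne a b with rfl | hab
      · simp [lagMat]
      · rw [diagonal_apply_ne _ hab, lagMat, of_apply]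
        exact Finset.prod_eq_zero (Finset.mem_erase.2 ⟨hab, Finset.mem_univ a⟩) (sub_self _)
    rw [this, det_diagonal]
  rw [key, det_mul, abs_mul] at h1 ⊢
  have h2 : |K.det| = |vand y| := by
    rw [← sq_abs] at h1
    have h3 : |(vandermonde y).det| = |vand y| := rfl
    rw [h3, sq] at h1
    exact mul_left_cancel₀ (abs_ne_zero.2 hy) h1
  rw [h2]
  rfl

/-- The weights of the rank one perturbation of `diag l` with eigenvalues `y`. -/
noncomputable def wt (l y : Fin p → ℝ) (a : Fin p) : ℝ :=
  -(∏ b, (l a - y b)) / ∏ c ∈ Finset.univ.erase a, (l a - l c)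

/-- The `y` that strictly interlace `l` from above. -/
def inter (l : Fin p → ℝ) : Set (Fin p → ℝ) :=
  {y | (∀ a, l a < y a) ∧ ∀ a b, a < b → y b < l a}

lemma inter_strictAnti {l y : Fin p → ℝ} (hy : y ∈ inter l) : StrictAnti y :=
  fun a b hab => (hy.2 a b hab).trans (hy.1 a)

lemma inter_ne {l y : Fin p → ℝ} (hl : StrictAnti l) (hy : y ∈ inter l) (a b : Fin p) :
    y b ≠ l a := by
  rcases lt_or_ge a b with h | h
  · exact (hy.2 a b h).ne
  · exact ((hl.antitone h).trans_lt (hy.1 b)).ne'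

lemma prod_erase_ne_zero {l : Fin p → ℝ} (hl : Function.Injective l) (a : Fin p) :
    ∏ c ∈ Finset.univ.erase a, (l a - l c) ≠ 0 :=
  Finset.prod_ne_zero_iff.2 fun _ hc => sub_ne_zero.2 fun h => (Finset.mem_erase.1 hc).1 (hl h).symm

lemma wt_pos {l y : Fin p → ℝ} (hl : StrictAnti l) (hy : y ∈ inter l) (a : Fin p) :
    0 < wt l y a := by
  have : wt l y a = (y a - l a) * ∏ c ∈ Finset.univ.erase a, ((l a - y c) / (l a - l c)) := by
    rw [wt, ← Finset.mul_prod_erase _ _ (Finset.mem_univ a), Finset.prod_div_distrib]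
    ring
  rw [this]
  refine mul_pos (sub_pos.2 (hy.1 a)) (Finset.prod_pos fun c hc => ?_)
  rcases lt_or_gt_of_ne (Finset.mem_erase.1 hc).1 with h | h
  · exact div_pos_of_neg_of_neg (sub_neg.2 ((hl h).trans (hy.1 c))) (sub_neg.2 (hl h))
  · exact div_pos (sub_pos.2 (hy.2 a c h)) (sub_pos.2 (hl h))

lemma prod_sub_sub_prod {l : Fin p → ℝ} (hl : Function.Injective l) (y : Fin p → ℝ) (z : ℝ) :
    ∏ c, (z - l c) - ∏ c, (z - y c) =
      ∑ a, wt l y a * ∏ c ∈ Finset.univ.erase a, (z - l c) := by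
  have hmon (k : Fin p → ℝ) : (∏ c, (Polynomial.X - Polynomial.C (k c))).Monic :=
    Polynomial.monic_prod_of_monic _ _ fun i _ => Polynomial.monic_X_sub_C _
  have hdeg (k : Fin p → ℝ) : (∏ c, (Polynomial.X - Polynomial.C (k c))).degree =
      (p : WithBot ℕ) := by
    simp [Polynomial.degree_prod]
  have hev (k : Fin p → ℝ) (x : ℝ) :
      (∏ c, (Polynomial.X - Polynomial.C (k c))).eval x = ∏ c, (x - k c) := by
    simp [Polynomial.eval_prod]
  have hlt : (∏ c, (Polynomial.X - Polynomial.C (l c)) -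
      ∏ c, (Polynomial.X - Polynomial.C (y c))).degree <
      ((Finset.univ : Finset (Fin p)).card : WithBot ℕ) := by
    have := Polynomial.degree_sub_lt_left (p := ∏ c, (Polynomial.X - Polynomial.C (l c)))
      (q := ∏ c, (Polynomial.X - Polynomial.C (y c)))
      (by rw [hdeg, hdeg]) (hmon l).ne_zero (by rw [hmon l, hmon y])
    simpa [hdeg] using this
  have h := congrArg (Polynomial.eval z) (Lagrange.eq_interpolate hl.injOn hlt)
  rw [Polynomial.eval_sub, hev, hev] at h
  rw [h, Lagrange.interpolate_apply, Polynomial.eval_finsetSum]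
  refine Finset.sum_congr rfl fun a _ => ?_
  rw [Polynomial.eval_mul, Polynomial.eval_C, Polynomial.eval_sub, hev, hev,
    Finset.prod_eq_zero (f := fun c => l a - l c) (Finset.mem_univ a) (sub_self _), zero_sub, wt,
    Lagrange.basis, Polynomial.eval_prod]
  simp only [Lagrange.basisDivisor, Polynomial.eval_mul, Polynomial.eval_C, Polynomial.eval_sub,
    Polynomial.eval_X, Finset.prod_mul_distrib, Finset.prod_inv_distrib]
  ring

lemma sum_wt_div {l y : Fin p → ℝ} (hl : Function.Injective l) (hy : ∀ a b, y b ≠ l a)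
    (b : Fin p) : ∑ c, wt l y c / (y b - l c) = 1 := by
  have h := prod_sub_sub_prod hl y (y b)
  rw [Finset.prod_eq_zero (f := fun c => y b - y c) (Finset.mem_univ b) (sub_self _), sub_zero] at h
  have hne : ∏ c, (y b - l c) ≠ 0 :=
    Finset.prod_ne_zero_iff.2 fun c _ => sub_ne_zero.2 (hy c b)
  rw [← mul_right_inj' hne, mul_one]
  conv_rhs => rw [h]
  rw [Finset.mul_sum]
  refine Finset.sum_congr rfl fun a _ => ?_
  have := sub_ne_zero.2 (hy a b)
  rw [← Finset.mul_prod_erase _ _ (Finset.mem_univ a)]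
  field_simp

lemma wt_injOn {l : Fin p → ℝ} (hl : StrictAnti l) : Set.InjOn (wt l) (inter l) := by
  have hsub {y y' : Fin p → ℝ} (h : wt l y = wt l y') : Set.range y ⊆ Set.range y' := by
    rintro _ ⟨b, rfl⟩
    have h1 := prod_sub_sub_prod hl.injective y (y b)
    rw [h, ← prod_sub_sub_prod hl.injective y' (y b)] at h1
    rw [Finset.prod_eq_zero (f := fun c => y b - y c) (Finset.mem_univ b) (sub_self _), sub_zero,
      eq_comm, sub_eq_self, Finset.prod_eq_zero_iff] at h1
    obtain ⟨c, _, hc⟩ := h1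
    exact ⟨c, by linarith⟩
  intro y hy y' hy' h
  exact (StrictAnti.range_inj (inter_strictAnti hy) (inter_strictAnti hy')).1
    ((hsub h).antisymm (hsub h.symm))

end

section
variable {p : ℕ}

lemma vand_ne_zero_of_injective {y : Fin p → ℝ} (hy : Function.Injective y) : vand y ≠ 0 :=
  det_vandermonde_ne_zero_iff.2 hy

/-- The Jacobian matrix of `wt l`. -/
noncomputable def wtJac (l y : Fin p → ℝ) : Matrix (Fin p) (Fin p) ℝ :=
  diagonal (fun a => (∏ c ∈ Finset.univ.erase a, (l a - l c))⁻¹) * lagMat l y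

lemma hasFDerivAt_wt (l y : Fin p → ℝ) :
    HasFDerivAt (wt l) (LinearMap.toContinuousLinearMap (toLin' (wtJac l y))) y := by
  rw [hasFDerivAt_pi']
  intro a
  have h1 (b : Fin p) : HasFDerivAt (fun x : Fin p → ℝ => l a - x b)
      (-(ContinuousLinearMap.proj (R := ℝ) (φ := fun _ : Fin p => ℝ) b)) y :=
    (hasFDerivAt_apply b y).const_sub (l a)
  have h2 := HasFDerivAt.finsetProd (u := Finset.univ) (fun b _ => h1 b)
  have h3 := (h2.neg).mul_const ((∏ c ∈ Finset.univ.erase a, (l a - l c))⁻¹)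
  refine h3.congr_fderiv ?_
  ext1 v
  simp [wtJac, toLin'_apply, mulVec, dotProduct, lagMat, Finset.mul_sum, diagonal_mul, mul_assoc]

lemma abs_det_wtJac {l y : Fin p → ℝ} (hl : Function.Injective l) (hy : Function.Injective y) :
    |(wtJac l y).det| = |vand y| / |vand l| := by
  have := vand_ne_zero_of_injective hl
  rw [wtJac, det_mul, det_diagonal, abs_mul, abs_det_lagMat (vand_ne_zero_of_injective hy),
    Finset.prod_inv_distrib, abs_inv, prod_erase_sub, ← sq_abs]
  have := abs_ne_zero.2 this
  field_simp

lemma eq_wt_of_sum_div_eq_one {l y s : Fin p → ℝ} (hl : StrictAnti l) (hy : y ∈ inter l)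
    (h : ∀ b, ∑ c, s c / (y b - l c) = 1) : wt l y = s := by
  have hyi := (inter_strictAnti hy).injective
  have hdet : (lagMat l y).det ≠ 0 := by
    rw [← abs_ne_zero, abs_det_lagMat (vand_ne_zero_of_injective hyi)]
    exact mul_ne_zero (abs_ne_zero.2 (vand_ne_zero_of_injective hl.injective))
      (abs_ne_zero.2 (vand_ne_zero_of_injective hyi))
  by_contra hne
  apply hdet
  rw [← exists_vecMul_eq_zero_iff]
  have hP (c : Fin p) : ∏ b, (l c - y b) ≠ 0 :=
    Finset.prod_ne_zero_iff.2 fun b _ => sub_ne_zero.2 (inter_ne hl hy c b).symm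
  refine ⟨fun c => (wt l y c - s c) / ∏ b, (l c - y b), fun h0 => hne ?_, ?_⟩
  · ext c
    have := congrFun h0 c
    simpa [hP c, sub_eq_zero] using this
  · ext b
    have h1 := sum_wt_div hl.injective (inter_ne hl hy) b
    rw [← h b, ← sub_eq_zero, ← Finset.sum_sub_distrib] at h1
    rw [vecMul, dotProduct, Pi.zero_apply, ← neg_eq_zero, ← h1, ← Finset.sum_neg_distrib]
    refine Finset.sum_congr rfl fun c _ => ?_
    have h2 := hP c
    rw [← Finset.mul_prod_erase _ _ (Finset.mem_univ b)] at h2 ⊢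
    have h3 := sub_ne_zero.2 (inter_ne hl hy c b)
    have h4 := left_ne_zero_of_mul h2
    have h5 := right_ne_zero_of_mul h2
    rw [lagMat, of_apply]
    rw [← sub_div, ← neg_sub (l c) (y b)]
    field_simp

lemma exists_root {l s : Fin p → ℝ} (hl : StrictAnti l) (hs : ∀ a, 0 < s a) (a : Fin p) :
    ∃ z, (∀ c, z ≠ l c) ∧ ∑ c, s c / (z - l c) = 1 ∧ l a < z ∧ ∀ b < a, z < l b := by
  set P : ℝ → ℝ := fun z => ∏ c, (z - l c) - ∑ a, s a * ∏ c ∈ Finset.univ.erase a, (z - l c) with hP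
  have hPc : Continuous P := by fun_prop
  have hPl (a : Fin p) : P (l a) = - (s a * ∏ c ∈ Finset.univ.erase a, (l a - l c)) := by
    simp only [hP]
    rw [Finset.prod_eq_zero (f := fun c => l a - l c) (Finset.mem_univ a) (sub_self _), zero_sub,
      Finset.sum_eq_single a]
    · intro b _ hb
      rw [Finset.prod_eq_zero (f := fun c => l a - l c)
        (Finset.mem_erase.2 ⟨hb.symm, Finset.mem_univ a⟩) (sub_self _), mul_zero]
    · simp
  have hPz (z : ℝ) (hz : ∀ c, z ≠ l c) : P z = (∏ c, (z - l c)) * (1 - ∑ c, s c / (z - l c)) := by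
    simp only [hP]
    rw [mul_sub, mul_one, Finset.mul_sum]
    congr 1
    refine Finset.sum_congr rfl fun a _ => ?_
    have := sub_ne_zero.2 (hz a)
    rw [← Finset.mul_prod_erase _ _ (Finset.mem_univ a)]
    field_simp
  have hroot (z : ℝ) (hz : P z = 0) : (∀ c, z ≠ l c) ∧ ∑ c, s c / (z - l c) = 1 := by
    have h1 (c : Fin p) : z ≠ l c := by
      rintro rfl
      rw [hPl, neg_eq_zero] at hz
      exact mul_ne_zero (hs c).ne' (prod_erase_ne_zero hl.injective c) hz
    refine ⟨h1, ?_⟩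
    rw [hPz z h1] at hz
    have h2 : ∏ c, (z - l c) ≠ 0 := Finset.prod_ne_zero_iff.2 fun c _ => sub_ne_zero.2 (h1 c)
    have := (mul_eq_zero.1 hz).resolve_left h2
    linarith
  by_cases ha : (a : ℕ) = 0
  · have hmin (c : Fin p) : a ≤ c := by rw [Fin.le_def, ha]; exact Nat.zero_le _
    set S := ∑ c, s c with hS
    have hS0 : 0 < S := Finset.sum_pos (fun c _ => hs c) ⟨a, Finset.mem_univ a⟩
    have h1 : P (l a) < 0 := by
      rw [hPl, neg_lt_zero]
      refine mul_pos (hs a) (Finset.prod_pos fun c hc => sub_pos.2 (hl ?_))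
      exact lt_of_le_of_ne (hmin c) (Finset.mem_erase.1 hc).1.symm
    have hge (c : Fin p) : S ≤ l a + S - l c := by linarith [hl.antitone (hmin c)]
    have h2 : 0 ≤ P (l a + S) := by
      rw [hPz _ fun c => by have := hge c; intro h; linarith]
      refine mul_nonneg (Finset.prod_nonneg fun c _ => hS0.le.trans (hge c)) (sub_nonneg.2 ?_)
      calc ∑ c, s c / (l a + S - l c) ≤ ∑ c, s c / S :=
            Finset.sum_le_sum fun c _ => div_le_div_of_nonneg_left (hs c).le hS0 (hge c)
        _ = 1 := by rw [← Finset.sum_div, ← hS, div_self hS0.ne']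
    obtain ⟨z, hz, hz0⟩ := intermediate_value_Icc (by linarith : l a ≤ l a + S) hPc.continuousOn
      (⟨h1.le, h2⟩ : (0 : ℝ) ∈ Set.Icc _ _)
    have h3 := hroot z hz0
    refine ⟨z, h3.1, h3.2, lt_of_le_of_ne hz.1 (h3.1 a).symm, fun b hb => ?_⟩
    exact absurd hb (hmin b).not_gt
  · set a' : Fin p := ⟨a - 1, by omega⟩ with ha'
    have haa : a' < a := by rw [Fin.lt_def]; simp [ha']; omega
    have hbt (b : Fin p) (hb : b < a) : b ≤ a' := by
      rw [Fin.lt_def] at hb; rw [Fin.le_def]; simp [ha']; omega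
    have hlt : l a < l a' := hl haa
    have h1 : P (l a) * P (l a') < 0 := by
      rw [hPl, hPl, neg_mul_neg]
      rw [← Finset.mul_prod_erase (Finset.univ.erase a) (fun c => l a - l c)
          (Finset.mem_erase.2 ⟨haa.ne, Finset.mem_univ a'⟩),
        ← Finset.mul_prod_erase (Finset.univ.erase a') (fun c => l a' - l c)
          (Finset.mem_erase.2 ⟨haa.ne', Finset.mem_univ a⟩), Finset.erase_right_comm]
      have h4 : 0 < (∏ c ∈ (Finset.univ.erase a').erase a, (l a - l c)) *
          ∏ c ∈ (Finset.univ.erase a').erase a, (l a' - l c) := by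
        rw [← Finset.prod_mul_distrib]
        refine Finset.prod_pos fun c hc => ?_
        rw [Finset.mem_erase, Finset.mem_erase] at hc
        rcases lt_or_gt_of_ne hc.1 with h | h
        · have h6 := lt_of_le_of_ne (hbt c h) hc.2.1
          exact mul_pos_of_neg_of_neg (sub_neg.2 (hl h)) (sub_neg.2 (hl h6))
        · exact mul_pos (sub_pos.2 (hl h)) (sub_pos.2 (hl (haa.trans h)))
      have h5 : (l a - l a') * (l a' - l a) < 0 :=
        mul_neg_of_neg_of_pos (sub_neg.2 hlt) (sub_pos.2 hlt)
      have h6 := mul_pos (mul_pos (hs a) (hs a')) h4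
      nlinarith [mul_neg_of_pos_of_neg h6 h5]
    have h2 : ∃ z ∈ Set.Ioo (l a) (l a'), P z = 0 := by
      rcases mul_neg_iff.1 h1 with h | h
      · exact intermediate_value_Ioo' hlt.le hPc.continuousOn ⟨h.2, h.1⟩
      · exact intermediate_value_Ioo hlt.le hPc.continuousOn ⟨h.1, h.2⟩
    obtain ⟨z, hz, hz0⟩ := h2
    have h3 := hroot z hz0
    exact ⟨z, h3.1, h3.2, hz.1, fun b hb => hz.2.trans_le (hl.antitone (hbt b hb))⟩

lemma wt_image {l : Fin p → ℝ} (hl : StrictAnti l) : wt l '' inter l = orthant (Fin p) := by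
  ext s
  constructor
  · rintro ⟨y, hy, rfl⟩
    exact fun a _ => wt_pos hl hy a
  · intro hs
    choose y _ h1 h2 h3 using exists_root hl (fun a => hs a (Set.mem_univ a))
    have hy : y ∈ inter l := ⟨h2, fun a b hab => h3 b a hab⟩
    exact ⟨y, hy, eq_wt_of_sum_div_eq_one hl hy h1⟩

lemma measurableSet_inter (l : Fin p → ℝ) : MeasurableSet (inter l) := by
  have : inter l = (⋂ a, {y | l a < y a}) ∩ ⋂ a, ⋂ b, ⋂ (_ : a < b), {y | y b < l a} := by
    ext y; simp [inter]
  rw [this]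
  refine .inter (.iInter fun a => ?_) (.iInter fun a => .iInter fun b => .iInter fun _ => ?_)
  · exact measurableSet_lt measurable_const (measurable_pi_apply a)
  · exact measurableSet_lt (measurable_pi_apply b) measurable_const

lemma integral_inter {L : Matrix (Fin p) (Fin p) ℂ →+ ℝ} (hL : Continuous L) {l : Fin p → ℝ}
    (hl : StrictAnti l) {θ : ℂ} (hθ : 0 < θ.re) :
    ∫ y in inter l, ((vand y : ℝ) * orb L (rdiag y)) * ∏ a, Complex.exp (-θ * (y a - l a)) =
      kap L θ * ((vand l : ℝ) * orb L (rdiag l)) := by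
  have h := integral_orb_rankOne_orthant hL l hθ
  have hvl : ((vand l : ℝ) : ℂ) ≠ 0 := by
    exact_mod_cast vand_ne_zero_of_injective hl.injective
  rw [← wt_image hl, integral_image_eq_integral_abs_det_fderiv_smul volume (measurableSet_inter l)
    (fun y _ => (hasFDerivAt_wt l y).hasFDerivWithinAt) (wt_injOn hl)] at h
  rw [mul_left_comm, ← h, ← integral_const_mul]
  refine setIntegral_congr_fun (measurableSet_inter l) fun y hy => ?_
  obtain ⟨W, hW⟩ := exists_cnj_rankOne (wt_pos hl hy) (inter_strictAnti hy).injective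
    (inter_ne hl hy) (sum_wt_div hl.injective (inter_ne hl hy))
  have htr := congrArg Matrix.trace hW
  rw [trace_cnj, Matrix.trace_add, rdiag, rdiag, rankOne, trace_diagonal, trace_diagonal,
    trace_vecMulVec] at htr
  have hs : ∑ a, (wt l y a : ℂ) = ∑ a, ((y a : ℂ) - l a) := by
    rw [Finset.sum_sub_distrib, ← htr, add_sub_cancel_left, dotProduct]
    refine Finset.sum_congr rfl fun a _ => ?_
    rw [← Complex.ofReal_mul, Real.mul_self_sqrt (wt_pos hl hy a).le]
  rw [hW, orb_cnj, hs, LinearMap.det_toContinuousLinearMap, LinearMap.det_toLin',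
    abs_det_wtJac hl.injective (inter_strictAnti hy).injective, Finset.mul_sum, Complex.exp_sum,
    ← abs_div, abs_of_pos, Complex.real_smul]
  · push_cast
    field_simp
  · have := vand_mul_pos hl (inter_strictAnti hy)
    rcases mul_pos_iff.1 this with h | h
    · exact div_pos h.1 h.2
    · exact div_pos_of_neg_of_neg h.1 h.2

end

section
variable {p : ℕ} {L : Matrix (Fin p) (Fin p) ℂ →+ ℝ}

/-- The Vandermonde determinant times the orbital integral. -/
noncomputable def altOrb (L : Matrix (Fin p) (Fin p) ℂ →+ ℝ) (y : Fin p → ℝ) : ℂ :=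
  (vand y : ℝ) * orb L (rdiag y)

lemma vand_comp_perm {R : Type*} [CommRing R] (y : Fin p → R) (σ : Equiv.Perm (Fin p)) :
    vand (y ∘ σ) = Equiv.Perm.sign σ * vand y := by
  rw [vand, vand, ← det_permute]
  rfl

lemma altOrb_comp_perm (y : Fin p → ℝ) (σ : Equiv.Perm (Fin p)) :
    altOrb L (y ∘ σ) = Equiv.Perm.sign σ * altOrb L y := by
  obtain ⟨W, hW⟩ := exists_cnj_rdiag_comp y σ
  rw [altOrb, altOrb, hW, orb_cnj, vand_comp_perm]
  push_cast
  ring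

lemma continuous_vand : Continuous (vand : (Fin p → ℝ) → ℝ) := by
  have : (vand : (Fin p → ℝ) → ℝ) = fun y => ∏ i, ∏ j ∈ Finset.Ioi i, (y j - y i) :=
    funext fun y => vand_eq y
  rw [this]
  fun_prop

lemma continuous_altOrb (hL : Continuous L) : Continuous (altOrb L) :=
  (Complex.continuous_ofReal.comp continuous_vand).mul ((continuous_orb hL).comp continuous_rdiag)

lemma integral_comp_perm {ι : Type*} [Fintype ι] (σ : Equiv.Perm ι) (G : (ι → ℝ) → ℂ) :
    ∫ y, G (y ∘ σ) = ∫ y, G y := by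
  have h := (volume_measurePreserving_piCongrLeft (fun _ : ι => ℝ) σ.symm).integral_comp' G
  rw [← h]
  congr 1
  ext y
  congr 1
  ext i
  have := MeasurableEquiv.piCongrLeft_apply_apply (β := fun _ : ι => ℝ) σ.symm y (σ i)
  simpa using this.symm

lemma integrable_comp_perm {ι : Type*} [Fintype ι] (σ : Equiv.Perm ι) {G : (ι → ℝ) → ℂ}
    (hG : Integrable G) : Integrable fun y => G (y ∘ σ) := by
  refine (MeasurePreserving.integrable_comp_emb
    (volume_measurePreserving_piCongrLeft (fun _ : ι => ℝ) σ.symm)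
    (MeasurableEquiv.measurableEmbedding _)).2 hG |>.congr (.of_forall fun y => ?_)
  have : MeasurableEquiv.piCongrLeft (fun _ : ι => ℝ) σ.symm y = y ∘ σ := by
    ext i
    have := MeasurableEquiv.piCongrLeft_apply_apply (β := fun _ : ι => ℝ) σ.symm y (σ i)
    simpa using this
  simp only [Function.comp_apply, this]

/-- Exponentially decaying measurable functions supported on the positive half line. -/
def Decays (h : ℝ → ℂ) : Prop :=
  Measurable h ∧ ∃ K, ∀ y, ‖h y‖ ≤ K * (Set.Ioi (0 : ℝ)).indicator (fun y => Real.exp (-y / 2)) y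

lemma Decays.integrable_pow_mul {h : ℝ → ℂ} (hh : Decays h) (k : ℕ) :
    Integrable fun y : ℝ => (y : ℂ) ^ k * h y := by
  obtain ⟨hm, K, hK⟩ := hh
  have h1 : IntegrableOn (fun y : ℝ => K * (y ^ k * Real.exp (-y / 2))) (Set.Ioi 0) := by
    have := integrableOn_rpow_mul_exp_neg_mul_rpow (s := k) (p := 1) (b := 1 / 2)
      (by have : (0 : ℝ) ≤ k := k.cast_nonneg
          linarith) zero_lt_one (by norm_num)
    refine Integrable.const_mul ((this.congr_fun (fun y _ => ?_) measurableSet_Ioi)) K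
    simp only [Real.rpow_natCast, Real.rpow_one]
    congr 2; ring
  rw [← integrable_indicator_iff measurableSet_Ioi] at h1
  refine h1.mono' (by fun_prop) (.of_forall fun y => ?_)
  rw [norm_mul, norm_pow, Complex.norm_real]
  refine (mul_le_mul_of_nonneg_left (hK y) (by positivity)).trans (le_of_eq ?_)
  by_cases hy : y ∈ Set.Ioi (0 : ℝ)
  · rw [Set.indicator_of_mem hy, Set.indicator_of_mem hy, Real.norm_of_nonneg (le_of_lt hy)]
    ring
  · rw [Set.indicator_of_notMem hy, Set.indicator_of_notMem hy]
    ring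

lemma integrable_altOrb_mul_prod (hL : Continuous L) {h : Fin p → ℝ → ℂ} (hh : ∀ a, Decays (h a)) :
    Integrable fun y : Fin p → ℝ => altOrb L y * ∏ a, h a (y a) := by
  have h1 (σ : Equiv.Perm (Fin p)) :
      Integrable fun y : Fin p → ℝ => ∏ a, ((y a : ℂ) ^ (σ a : ℕ) * h a (y a)) :=
    Integrable.fintype_prod fun a => (hh a).integrable_pow_mul (σ a)
  have h2 : Integrable fun y : Fin p → ℝ => ∑ σ : Equiv.Perm (Fin p),
      (Equiv.Perm.sign σ : ℂ) * ∏ a, ((y a : ℂ) ^ (σ a : ℕ) * h a (y a)) :=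
    integrable_finsetSum _ fun σ _ => (h1 σ).const_mul _
  have h3 := h2.bdd_mul (c := 1) (f := fun y : Fin p → ℝ => orb L (rdiag y))
    ((continuous_orb hL).comp continuous_rdiag).aestronglyMeasurable
    (.of_forall fun y => norm_orb_le _)
  refine h3.congr (.of_forall fun y => ?_)
  simp only [altOrb, vand]
  rw [← det_transpose, det_apply']
  push_cast
  rw [mul_comm (Finset.sum _ _), mul_assoc, Finset.sum_mul]
  congr 1
  refine Finset.sum_congr rfl fun σ _ => ?_
  rw [Finset.prod_mul_distrib, mul_assoc]
  simp [vandermonde_apply]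

lemma integral_altOrb_mul_det (hL : Continuous L) {h : Fin p → ℝ → ℂ} (hh : ∀ a, Decays (h a)) :
    ∫ y : Fin p → ℝ, altOrb L y * (of fun a b => h a (y b)).det =
      (p.factorial : ℂ) * ∫ y : Fin p → ℝ, altOrb L y * ∏ a, h a (y a) := by
  have key (σ : Equiv.Perm (Fin p)) (y : Fin p → ℝ) :
      altOrb L y * ((Equiv.Perm.sign σ : ℂ) * ∏ i, h (σ i) (y i)) =
        (fun x => altOrb L x * ∏ a, h a (x a)) (y ∘ σ.symm) := by
    simp only [altOrb_comp_perm, Function.comp_apply]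
    rw [← Equiv.prod_comp σ (fun a => h a (y (σ.symm a)))]
    simp
    ring
  simp_rw [det_apply', of_apply, Finset.mul_sum, key]
  rw [integral_finsetSum]
  · simp_rw [integral_comp_perm _ (fun x => altOrb L x * ∏ a, h a (x a))]
    simp [Fintype.card_perm]
  · intro σ _
    exact integrable_comp_perm σ.symm (integrable_altOrb_mul_prod hL hh)

end

section
variable {p : ℕ} {L : Matrix (Fin p) (Fin p) ℂ →+ ℝ}

/-- The truncated exponential `1[y > x] e^{-θ (y - x)}`. -/
noncomputable def expo (θ : ℂ) (x y : ℝ) : ℂ :=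
  (Set.Ioi x).indicator (fun y : ℝ => Complex.exp (-θ * (y - x))) y

lemma measurable_expo (θ : ℂ) : Measurable fun z : ℝ × ℝ => expo θ z.1 z.2 := by
  have : (fun z : ℝ × ℝ => expo θ z.1 z.2) = {z : ℝ × ℝ | z.1 < z.2}.indicator
      (fun z => Complex.exp (-θ * (z.2 - z.1))) := by
    ext z
    simp [expo, Set.indicator_apply]
  rw [this]
  exact Measurable.indicator (by fun_prop) (measurableSet_lt measurable_fst measurable_snd)

lemma norm_expo_le {θ : ℂ} (hθ : 1 ≤ θ.re) (x y : ℝ) :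
    ‖expo θ x y‖ ≤ Real.exp (-(y - x)) := by
  rw [expo, Set.indicator_apply]
  split_ifs with h
  · rw [Complex.norm_exp]
    have : (-θ * (y - x)).re = -θ.re * (y - x) := by
      rw [← Complex.ofReal_sub, Complex.re_mul_ofReal, Complex.neg_re]
    rw [this, Real.exp_le_exp]
    have : x < y := h
    nlinarith
  · rw [norm_zero]; positivity

lemma decays_expo {θ : ℂ} (hθ : 1 ≤ θ.re) {x : ℝ} (hx : 0 ≤ x) : Decays (expo θ x) := by
  refine ⟨(measurable_expo θ).comp (measurable_const.prodMk measurable_id), Real.exp x, fun y => ?_⟩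
  by_cases hy : y ∈ Set.Ioi (0 : ℝ)
  · rw [Set.indicator_of_mem hy, ← Real.exp_add]
    refine (norm_expo_le hθ x y).trans (Real.exp_le_exp.2 ?_)
    have : 0 < y := hy
    linarith
  · have : y ∉ Set.Ioi x := fun h => hy (hx.trans_lt h)
    rw [Set.indicator_of_notMem hy, expo, Set.indicator_of_notMem this]
    simp

/-- The truncation of `expo θ (l a)` to points below all previous `l b`. -/
noncomputable def expoTrunc (θ : ℂ) (l : Fin p → ℝ) (a : Fin p) (y : ℝ) : ℂ :=
  {y | l a < y ∧ ∀ b < a, y ≤ l b}.indicator (fun y : ℝ => Complex.exp (-θ * (y - l a))) y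

lemma det_expo {l : Fin p → ℝ} (hl : StrictAnti l) (θ : ℂ) (y : Fin p → ℝ) :
    (of fun a b => expo θ (l a) (y b)).det = (of fun a b => expoTrunc θ l a (y b)).det := by
  obtain _ | n := p
  · simp
  refine det_eq_of_forall_row_eq_smul_add_pred
    (fun i => Complex.exp (θ * (l i.succ - l i.castSucc))) (fun j => ?_) fun i j => ?_
  · simp [expo, expoTrunc, Set.indicator_apply]
  · have h0 : l i.succ < l i.castSucc := hl (Fin.castSucc_lt_succ)
    simp only [of_apply, expo, expoTrunc, Set.indicator_apply, Set.mem_Ioi, Set.mem_ofPred_eq]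
    by_cases h1 : l i.castSucc < y j
    · have h2 : ¬ (l i.succ < y j ∧ ∀ b < i.succ, y j ≤ l b) :=
        fun h => (h.2 i.castSucc Fin.castSucc_lt_succ).not_gt h1
      rw [if_pos (h0.trans h1), if_pos h1, if_neg h2, zero_add, ← Complex.exp_add]
      congr 1; ring
    · have h2 : ∀ b < i.succ, y j ≤ l b := fun b hb =>
        (not_lt.1 h1).trans (hl.antitone (Fin.le_castSucc_iff.2 hb))
      rw [if_neg h1, mul_zero, add_zero]
      simp only [and_iff_left h2]

lemma ae_ne_eval (a : Fin p) (x : ℝ) : ∀ᵐ y : Fin p → ℝ, y a ≠ x := by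
  rw [ae_iff]
  simpa [volume_pi] using Measure.pi_hyperplane (fun _ : Fin p => (volume : Measure ℝ)) a x

lemma prod_expoTrunc_ae (l : Fin p → ℝ) (θ : ℂ) :
    (fun y : Fin p → ℝ => ∏ a, expoTrunc θ l a (y a)) =ᵐ[volume]
      (inter l).indicator fun y => ∏ a, Complex.exp (-θ * (y a - l a)) := by
  have : ∀ᵐ y : Fin p → ℝ, ∀ a b, y a ≠ l b :=
    ae_all_iff.2 fun a => ae_all_iff.2 fun b => ae_ne_eval a (l b)
  filter_upwards [this] with y hy
  classical
  rw [Set.indicator_apply]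
  split_ifs with h
  · refine Finset.prod_congr rfl fun a _ => ?_
    rw [expoTrunc, Set.indicator_of_mem]
    exact ⟨h.1 a, fun b hb => (h.2 b a hb).le⟩
  · by_contra h0
    rw [Finset.prod_eq_zero_iff] at h0
    refine h ⟨fun a => ?_, fun a b hab => ?_⟩
    · by_contra h1
      refine h0 ⟨a, Finset.mem_univ _, ?_⟩
      rw [expoTrunc, Set.indicator_of_notMem]
      exact fun h2 => h1 h2.1
    · by_contra h1
      refine h0 ⟨b, Finset.mem_univ _, ?_⟩
      rw [expoTrunc, Set.indicator_of_notMem]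
      exact fun h2 => h1 (lt_of_le_of_ne (h2.2 a hab) (hy b a))

lemma decays_expoTrunc {l : Fin p → ℝ} (hl0 : ∀ a, 0 ≤ l a) {θ : ℂ} (hθ : 1 ≤ θ.re) (a : Fin p) :
    Decays (expoTrunc θ l a) := by
  obtain ⟨-, K, hK⟩ := decays_expo hθ (hl0 a)
  refine ⟨?_, K, fun y => (le_trans ?_ (hK y))⟩
  · refine Measurable.indicator (by fun_prop) ?_
    rw [Set.ofPred_and]
    refine (measurableSet_Ioi).inter ?_
    simp only [Set.ofPred_forall]
    exact MeasurableSet.iInter fun b => MeasurableSet.iInter fun _ => measurableSet_Iic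
  · rw [expoTrunc, expo, Set.indicator_apply, Set.indicator_apply]
    split_ifs with h1 h2 h2
    · rfl
    · exact absurd h1.1 h2
    · simp
    · simp

lemma integral_altOrb_mul_expo_of_strictAnti (hL : Continuous L) {l : Fin p → ℝ}
    (hl : StrictAnti l) (hl0 : ∀ a, 0 ≤ l a) {θ : ℂ} (hθ : 1 ≤ θ.re) :
    ∫ y : Fin p → ℝ, altOrb L y * ∏ a, expo θ (l a) (y a) = kap L θ * altOrb L l := by
  have h1 := integral_altOrb_mul_det hL (fun a => decays_expo hθ (hl0 a))
  have h2 := integral_altOrb_mul_det hL (decays_expoTrunc hl0 hθ)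
  simp_rw [det_expo hl] at h1
  rw [h1] at h2
  rw [mul_left_cancel₀ (Nat.cast_ne_zero.2 p.factorial_ne_zero) h2, altOrb, ← integral_inter hL hl
    (zero_lt_one.trans_le hθ), ← integral_indicator (measurableSet_inter l)]
  refine integral_congr_ae ?_
  filter_upwards [prod_expoTrunc_ae l θ] with y hy
  classical
  rw [hy, Set.indicator_apply, Set.indicator_apply, altOrb]
  split_ifs <;> simp

/-- The reproducing property of `altOrb` under products of truncated exponentials. -/
lemma integral_altOrb_mul_expo (hL : Continuous L) {l : Fin p → ℝ}
    (hl0 : ∀ a, 0 ≤ l a) {θ : ℂ} (hθ : 1 ≤ θ.re) :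
    ∫ y : Fin p → ℝ, altOrb L y * ∏ a, expo θ (l a) (y a) = kap L θ * altOrb L l := by
  have hF (l : Fin p → ℝ) (σ : Equiv.Perm (Fin p)) :
      ∫ y : Fin p → ℝ, altOrb L y * ∏ a, expo θ (l (σ a)) (y a) =
        (Equiv.Perm.sign σ : ℂ) * ∫ y : Fin p → ℝ, altOrb L y * ∏ a, expo θ (l a) (y a) := by
    rw [← integral_comp_perm σ, ← integral_const_mul]
    congr 1
    ext y
    rw [altOrb_comp_perm, ← Equiv.prod_comp σ (fun a => expo θ (l a) (y a))]
    simp [mul_assoc]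
  by_cases hinj : Function.Injective l
  · let σ := Tuple.sort (fun a => -l a)
    have hσ : StrictAnti (l ∘ σ) := by
      have h1 : Monotone ((fun a => -l a) ∘ σ) := Tuple.monotone_sort _
      have h2 : Antitone (l ∘ σ) := fun a b hab => by simpa using h1 hab
      exact h2.strictAnti_of_injective (hinj.comp σ.injective)
    have h := integral_altOrb_mul_expo_of_strictAnti hL hσ (fun a => hl0 _) hθ
    simp only [Function.comp_apply] at h
    rw [hF, altOrb_comp_perm] at h
    have hs : (Equiv.Perm.sign σ : ℂ) ≠ 0 := by
      rcases Int.units_eq_one_or (Equiv.Perm.sign σ) with h | h <;> simp [h]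
    apply mul_left_cancel₀ hs
    rw [h]; ring
  · rw [Function.Injective] at hinj
    push Not at hinj
    obtain ⟨i, j, hij, hne⟩ := hinj
    have hl : l ∘ Equiv.swap i j = l := by
      ext a
      rcases eq_or_ne a i with rfl | hi
      · simp [hij]
      rcases eq_or_ne a j with rfl | hj
      · simp [hij]
      · simp [Equiv.swap_apply_of_ne_of_ne hi hj]
    have h1 := hF l (Equiv.swap i j)
    have h2 := altOrb_comp_perm (L := L) l (Equiv.swap i j)
    simp only [show ∀ a, l (Equiv.swap i j a) = l a from congrFun hl] at h1
    rw [hl] at h2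
    rw [Equiv.Perm.sign_swap hne] at h1 h2
    simp only [Units.val_neg, Units.val_one, Int.cast_neg, Int.cast_one, neg_mul, one_mul,
      self_eq_neg] at h1 h2
    rw [h1, h2, mul_zero]

end

section
variable {p : ℕ} {L : Matrix (Fin p) (Fin p) ℂ →+ ℝ}

lemma gaussK_ofReal {t : ℝ} (ht : 0 < t) : ∃ c : ℝ, c ≠ 0 ∧
    gaussK L t = c * ∫ v : Fin p → ℂ,
      Complex.exp (L ((t⁻¹ : ℝ) • vecMulVec v (star v)) * Complex.I) *
      Complex.exp (-(1 : ℂ) * ∑ a, (Complex.normSq (v a) : ℂ)) := by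
  set R : ℝ := (Real.sqrt t)⁻¹ with hR
  have hR0 : R ≠ 0 := inv_ne_zero (Real.sqrt_pos.2 ht).ne'
  have hRR : R * R = t⁻¹ := by
    rw [hR, ← mul_inv, Real.mul_self_sqrt ht.le]
  have h := Measure.integral_comp_smul (volume : Measure (Fin p → ℂ))
    (fun v => Complex.exp (L (vecMulVec v (star v)) * Complex.I) *
      Complex.exp (-(t : ℂ) * ∑ a, (Complex.normSq (v a) : ℂ))) R
  have h1 (v : Fin p → ℂ) : vecMulVec (R • v) (star (R • v)) =
      (t⁻¹ : ℝ) • vecMulVec v (star v) := by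
    ext i j
    simp [vecMulVec_apply, ← hRR]
    ring
  have h2 (v : Fin p → ℂ) : -(t : ℂ) * ∑ a, (Complex.normSq ((R • v) a) : ℂ) =
      -(1 : ℂ) * ∑ a, (Complex.normSq (v a) : ℂ) := by
    have : (t : ℂ) * (R * R) = 1 := by
      rw [← Complex.ofReal_mul, hRR, ← Complex.ofReal_mul, mul_inv_cancel₀ ht.ne',
        Complex.ofReal_one]
    simp_rw [Pi.smul_apply, Complex.real_smul, Complex.normSq_mul, Complex.normSq_ofReal,
      Complex.ofReal_mul, ← Finset.mul_sum]
    linear_combination (-∑ a, (Complex.normSq (v a) : ℂ)) * this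
  simp_rw [h1, h2] at h
  refine ⟨(|(R ^ Module.finrank ℝ (Fin p → ℂ))⁻¹|)⁻¹, ?_, ?_⟩
  · simp [hR0]
  · rw [h, gaussK, Complex.real_smul, ← mul_assoc, ← Complex.ofReal_mul, inv_mul_cancel₀,
      Complex.ofReal_one, one_mul]
    simp [hR0]

lemma integral_gauss_ne_zero :
    ∫ v : Fin p → ℂ, Complex.exp (-(1 : ℂ) * ∑ a, (Complex.normSq (v a) : ℂ)) ≠ 0 := by
  have h1 (v : Fin p → ℂ) : Complex.exp (-(1 : ℂ) * ∑ a, (Complex.normSq (v a) : ℂ)) =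
      ((Real.exp (-∑ a, Complex.normSq (v a)) : ℝ) : ℂ) := by
    push_cast; congr 1; ring
  have h2 := integrable_gauss (p := p) (θ := 1) (by simp)
  simp_rw [h1] at h2 ⊢
  have h3 := integral_complex_ofReal (μ := (volume : Measure (Fin p → ℂ)))
    (f := fun v => Real.exp (-∑ a, Complex.normSq (v a)))
  rw [h3, Complex.ofReal_ne_zero]
  exact (integral_exp_pos (h2.re.congr (.of_forall fun v => Complex.ofReal_re _))).ne'

lemma eventually_kap_ne_zero (hL : Continuous L) :
    ∀ᶠ t : ℝ in Filter.atTop, kap L (t : ℂ) ≠ 0 := by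
  have hlim : Filter.Tendsto (fun t : ℝ => ∫ v : Fin p → ℂ,
      Complex.exp (L ((t⁻¹ : ℝ) • vecMulVec v (star v)) * Complex.I) *
      Complex.exp (-(1 : ℂ) * ∑ a, (Complex.normSq (v a) : ℂ))) Filter.atTop
      (nhds (∫ v : Fin p → ℂ, Complex.exp (-(1 : ℂ) * ∑ a, (Complex.normSq (v a) : ℂ)))) := by
    refine tendsto_integral_filter_of_dominated_convergence
      (fun v => ‖Complex.exp (-(1 : ℂ) * ∑ a, (Complex.normSq (v a) : ℂ))‖) ?_ ?_
      (integrable_gauss (θ := 1) (by simp)).norm ?_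
    · refine .of_forall fun t => Continuous.aestronglyMeasurable ?_
      have h0 : Continuous fun v : Fin p → ℂ => L ((t⁻¹ : ℝ) • vecMulVec v (star v)) :=
        hL.comp ((continuous_const_smul _).comp continuous_vecMulVec_star)
      have h1 := Complex.continuous_normSq
      fun_prop
    · refine .of_forall fun t => .of_forall fun v => ?_
      rw [norm_mul, Complex.norm_exp_ofReal_mul_I, one_mul]
    · refine .of_forall fun v => ?_
      have h1 : Filter.Tendsto (fun t : ℝ => L ((t⁻¹ : ℝ) • vecMulVec v (star v))) Filter.atTop
          (nhds (L ((0 : ℝ) • vecMulVec v (star v)))) :=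
        (hL.tendsto _).comp (tendsto_inv_atTop_zero.smul_const _)
      rw [zero_smul, map_zero] at h1
      have h2 := (Complex.continuous_exp.tendsto _).comp
        (((Complex.continuous_ofReal.tendsto _).comp h1).mul_const Complex.I)
      have h3 := h2.mul_const (Complex.exp (-(1 : ℂ) * ∑ a, (Complex.normSq (v a) : ℂ)))
      simpa using h3
  filter_upwards [hlim.eventually_ne integral_gauss_ne_zero, Filter.eventually_gt_atTop 0]
    with t h1 h2
  obtain ⟨c, hc, h⟩ := gaussK_ofReal (L := L) h2
  rw [kap, h]
  exact div_ne_zero (mul_ne_zero (by exact_mod_cast hc) h1) (by simp [Real.pi_ne_zero])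

end

section
variable {p : ℕ} {L : Matrix (Fin p) (Fin p) ℂ →+ ℝ}

lemma vand_eq_prod_ite {R : Type*} [CommRing R] (z : Fin p → R) :
    vand z = ∏ i, ∏ j, if i < j then z j - z i else 1 := by
  rw [vand_eq]
  refine Finset.prod_congr rfl fun i _ => ?_
  rw [← Finset.prod_filter]
  congr 1
  ext j
  simp

lemma exists_vand_update {R : Type*} [CommRing R] (y : Fin p → R) (c : Fin p) :
    ∃ C : R, ∀ t, vand (Function.update y c t) = C * ∏ b ∈ Finset.univ.erase c, (t - y b) := by
  refine ⟨(∏ i ∈ Finset.univ.erase c, ∏ j ∈ Finset.univ.erase c, if i < j then y j - y i else 1) *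
    ∏ j ∈ Finset.univ.erase c, if c < j then -1 else 1, fun t => ?_⟩
  have h2 (F : Fin p → Fin p → R) (hF : F c c = 1) : ∏ i, ∏ j, F i j =
      (∏ i ∈ Finset.univ.erase c, ∏ j ∈ Finset.univ.erase c, F i j) *
        ∏ i ∈ Finset.univ.erase c, (F c i * F i c) := by
    simp_rw [← Finset.mul_prod_erase Finset.univ _ (Finset.mem_univ c)]
    rw [hF, Finset.prod_mul_distrib, Finset.prod_mul_distrib]
    ring
  rw [vand_eq_prod_ite, h2 _ (if_neg (lt_irrefl c)), mul_assoc]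
  congr 1
  · refine Finset.prod_congr rfl fun i hi => Finset.prod_congr rfl fun j hj => ?_
    rw [Function.update_of_ne (Finset.ne_of_mem_erase hi),
      Function.update_of_ne (Finset.ne_of_mem_erase hj)]
  · rw [← Finset.prod_mul_distrib]
    refine Finset.prod_congr rfl fun i hi => ?_
    have hi := Finset.ne_of_mem_erase hi
    rw [Function.update_of_ne hi, Function.update_self]
    rcases lt_or_gt_of_ne hi with h | h
    · simp [h, h.not_gt]
    · simp [h, h.not_gt]

lemma vand_update {R : Type*} [CommRing R] (y : Fin p → R) (c : Fin p) (t : R) :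
    vand (Function.update y c t) * ∏ b ∈ Finset.univ.erase c, (y c - y b) =
      vand y * ∏ b ∈ Finset.univ.erase c, (t - y b) := by
  obtain ⟨C, hC⟩ := exists_vand_update y c
  have := hC (y c)
  rw [Function.update_eq_self] at this
  rw [this, hC]
  ring

lemma integral_expo_mul_expo (η θ : ℂ) (y : ℝ) :
    (θ - η) * ∫ l : ℝ, expo η 0 l * expo θ l y = expo η 0 y - expo θ 0 y := by
  rcases eq_or_ne θ η with rfl | hne
  · simp
  have h1 (l : ℝ) : expo η 0 l * expo θ l y = (Set.Ioo 0 y).indicator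
      (fun l : ℝ => Complex.exp (-θ * y) * Complex.exp ((θ - η) * l)) l := by
    simp only [expo, Set.indicator_apply, Set.mem_Ioi, Set.mem_Ioo]
    by_cases h : 0 < l <;> by_cases h' : l < y <;> simp only [h, h', if_true, if_false,
      mul_zero, zero_mul, and_self, and_true, and_false]
    rw [← Complex.exp_add, ← Complex.exp_add]
    congr 1
    push_cast; ring
  simp_rw [h1]
  rw [integral_indicator measurableSet_Ioo]
  by_cases hy : 0 < y
  · rw [← integral_Ioc_eq_integral_Ioo, ← intervalIntegral.integral_of_le hy.le,
      intervalIntegral.integral_const_mul, integral_exp_mul_complex (sub_ne_zero.2 hne)]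
    rw [expo, expo, Set.indicator_of_mem (by exact hy), Set.indicator_of_mem (by exact hy)]
    have := sub_ne_zero.2 hne
    field_simp
    simp only [mul_sub, ← Complex.exp_add]
    simp
    congr 1
    ring_nf
  · rw [Set.Ioo_eq_empty (by simpa using hy)]
    have : y ∉ Set.Ioi (0 : ℝ) := hy
    simp [expo, this]

/-- The Laplace transform of `altOrb`. -/
noncomputable def lap (L : Matrix (Fin p) (Fin p) ℂ →+ ℝ) (η : Fin p → ℂ) : ℂ :=
  ∫ y : Fin p → ℝ, altOrb L y * ∏ a, expo (η a) 0 (y a)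

/-- The function `1[y > 0] e^{-y / 2}`. -/
noncomputable def halfExp : ℝ → ℝ := (Set.Ioi (0 : ℝ)).indicator (fun y => Real.exp (-y / 2))

lemma measurable_halfExp : Measurable halfExp :=
  Measurable.indicator (by fun_prop) measurableSet_Ioi

lemma halfExp_nonneg (y : ℝ) : 0 ≤ halfExp y :=
  Set.indicator_nonneg (fun _ _ => (Real.exp_pos _).le) y

lemma decays_halfExp : Decays fun y => (halfExp y : ℂ) := by
  refine ⟨Complex.measurable_ofReal.comp measurable_halfExp, 1, fun y => ?_⟩
  rw [Complex.norm_real, Real.norm_of_nonneg (halfExp_nonneg y), one_mul, halfExp]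

lemma norm_expo_mul_expo_le {η θ : ℂ} (hη : 1 ≤ η.re) (hθ : 1 ≤ θ.re) (l y : ℝ) :
    ‖expo η 0 l * expo θ l y‖ ≤ halfExp l * halfExp y := by
  by_cases hl : 0 < l
  · by_cases hy : l < y
    · rw [norm_mul]
      refine (mul_le_mul (norm_expo_le hη 0 l) (norm_expo_le hθ l y) (norm_nonneg _)
        (Real.exp_pos _).le).trans ?_
      rw [halfExp, Set.indicator_of_mem (by exact hl), Set.indicator_of_mem (by exact hl.trans hy),
        ← Real.exp_add, ← Real.exp_add, Real.exp_le_exp]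
      linarith
    · have : y ∉ Set.Ioi l := hy
      rw [expo.eq_1 θ, Set.indicator_of_notMem this, mul_zero, norm_zero]
      exact mul_nonneg (halfExp_nonneg _) (halfExp_nonneg _)
  · have : l ∉ Set.Ioi (0 : ℝ) := hl
    rw [expo, Set.indicator_of_notMem this, zero_mul, norm_zero]
    exact mul_nonneg (halfExp_nonneg _) (halfExp_nonneg _)

lemma kap_mul_lap (hL : Continuous L) {η : Fin p → ℂ} (hη : ∀ a, 1 ≤ (η a).re) {θ : ℂ}
    (hθ : 1 ≤ θ.re) :
    kap L θ * (∏ a, (θ - η a)) * lap L η =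
      ∫ y : Fin p → ℝ, altOrb L y * ∏ a, (expo (η a) 0 (y a) - expo θ 0 (y a)) := by
  have hint : Integrable (Function.uncurry fun (l y : Fin p → ℝ) =>
      altOrb L y * ∏ a, (expo (η a) 0 (l a) * expo θ (l a) (y a))) (volume.prod volume) := by
    have h1 : Integrable fun l : Fin p → ℝ => ∏ a, ((halfExp (l a) : ℝ) : ℂ) :=
      Integrable.fintype_prod fun a => by simpa using decays_halfExp.integrable_pow_mul 0
    have h2 := integrable_altOrb_mul_prod hL (fun _ : Fin p => decays_halfExp)
    refine (h1.mul_prod h2).mono ?_ (.of_forall fun z => ?_)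
    · have h3 := (continuous_altOrb hL).measurable
      refine Measurable.aestronglyMeasurable ((h3.comp measurable_snd).mul ?_)
      refine Finset.measurable_fun_prod _ fun a _ => ?_
      refine Measurable.mul ?_ ?_
      · exact (measurable_expo (η a)).comp
          (f := fun z : (Fin p → ℝ) × (Fin p → ℝ) => ((0 : ℝ), z.1 a))
          (by fun_prop)
      · exact (measurable_expo θ).comp (f := fun z : (Fin p → ℝ) × (Fin p → ℝ) => (z.1 a, z.2 a))
          (by fun_prop)
    · simp only [Function.uncurry]
      rw [norm_mul, norm_prod, norm_mul, norm_mul, norm_prod, norm_prod, mul_left_comm,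
        ← Finset.prod_mul_distrib]
      refine mul_le_mul_of_nonneg_left ?_ (norm_nonneg _)
      refine Finset.prod_le_prod (fun _ _ => norm_nonneg _) fun a _ => ?_
      rw [Complex.norm_real, Complex.norm_real, Real.norm_of_nonneg (halfExp_nonneg _),
        Real.norm_of_nonneg (halfExp_nonneg _)]
      exact norm_expo_mul_expo_le (hη a) hθ _ _
  have hsw := integral_integral_swap hint
  have hl (l : Fin p → ℝ) : ∫ y : Fin p → ℝ,
      altOrb L y * ∏ a, (expo (η a) 0 (l a) * expo θ (l a) (y a)) =
      kap L θ * (altOrb L l * ∏ a, expo (η a) 0 (l a)) := by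
    by_cases hl0 : ∀ a, 0 ≤ l a
    · have := integral_altOrb_mul_expo hL hl0 hθ
      simp_rw [Finset.prod_mul_distrib, mul_left_comm (altOrb L _)]
      rw [integral_const_mul, this]
      ring
    · push Not at hl0
      obtain ⟨a, ha⟩ := hl0
      have : ∏ a, expo (η a) 0 (l a) = 0 := Finset.prod_eq_zero (Finset.mem_univ a) (by
        rw [expo, Set.indicator_of_notMem]
        exact ha.not_gt)
      simp_rw [Finset.prod_mul_distrib, this]
      simp
  have hy (y : Fin p → ℝ) : (∏ a, (θ - η a)) * ∫ l : Fin p → ℝ,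
      altOrb L y * ∏ a, (expo (η a) 0 (l a) * expo θ (l a) (y a)) =
      altOrb L y * ∏ a, (expo (η a) 0 (y a) - expo θ 0 (y a)) := by
    rw [integral_const_mul, integral_fintype_prod_volume_eq_prod
      (fun a (l : ℝ) => expo (η a) 0 l * expo θ l (y a)), mul_left_comm,
      ← Finset.prod_mul_distrib]
    simp_rw [integral_expo_mul_expo]
  simp_rw [hl] at hsw
  rw [integral_const_mul] at hsw
  simp_rw [← hy]
  rw [integral_const_mul, ← hsw, lap]
  ring

lemma decays_expo_sub {η θ : ℂ} (hη : 1 ≤ η.re) (hθ : 1 ≤ θ.re) :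
    Decays fun y => expo η 0 y - expo θ 0 y := by
  obtain ⟨h1, K1, h2⟩ := decays_expo hη le_rfl
  obtain ⟨h3, K2, h4⟩ := decays_expo hθ le_rfl
  refine ⟨h1.sub h3, K1 + K2, fun y => (norm_sub_le _ _).trans ?_⟩
  rw [add_mul]
  exact add_le_add (h2 y) (h4 y)

lemma integral_altOrb_swap (hL : Continuous L) {η : Fin p → ℂ} (hη : ∀ a, 1 ≤ (η a).re) {θ : ℂ}
    (hθ : 1 ≤ θ.re) (c : Fin p) :
    ∫ y : Fin p → ℝ, altOrb L y *
        ∏ a, (expo (Function.update η c θ a) 0 (y a) - expo (η c) 0 (y a)) =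
      -∫ y : Fin p → ℝ, altOrb L y * ∏ a, (expo (η a) 0 (y a) - expo θ 0 (y a)) := by
  have hη' (a : Fin p) : 1 ≤ (Function.update η c θ a).re := by
    rcases eq_or_ne a c with rfl | h
    · simpa using hθ
    · simpa [h] using hη a
  have h1 := integral_altOrb_mul_det hL (fun a => decays_expo_sub (hη' a) (hη c))
  have h2 := integral_altOrb_mul_det hL (fun a => decays_expo_sub (hη a) hθ)
  apply mul_left_cancel₀ (Nat.cast_ne_zero.2 p.factorial_ne_zero : (p.factorial : ℂ) ≠ 0)
  rw [mul_neg, ← h1, ← h2, ← integral_neg]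
  congr 1
  ext y
  rw [← mul_neg]
  congr 1
  set M : Matrix (Fin p) (Fin p) ℂ := of fun a b => expo (η a) 0 (y b) - expo θ 0 (y b) with hM
  have h3 : (of fun a b => M a b + (if a = c then 0 else -1) * M c b).det = M.det :=
    det_eq_of_forall_row_eq_smul_add_const (fun a => if a = c then 0 else -1) c (by simp)
      (fun i j => rfl)
  rw [← h3, ← neg_one_mul]
  have h4 : ∏ a : Fin p, (if a = c then (-1 : ℂ) else 1) = -1 := by simp
  rw [← h4, ← det_mul_column]
  congr 1
  ext a b
  rcases eq_or_ne a c with rfl | h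
  · simp [hM]
  · simp [hM, h]

lemma kap_mul_lap_update (hL : Continuous L) {η : Fin p → ℂ} (hη : ∀ a, 1 ≤ (η a).re) {θ : ℂ}
    (hθ : 1 ≤ θ.re) (c : Fin p) (hne : θ ≠ η c) :
    kap L θ * (∏ a ∈ Finset.univ.erase c, (θ - η a)) * lap L η =
      kap L (η c) * (∏ a ∈ Finset.univ.erase c, (η c - η a)) * lap L (Function.update η c θ) := by
  have hη' (a : Fin p) : 1 ≤ (Function.update η c θ a).re := by
    rcases eq_or_ne a c with rfl | h
    · simpa using hθ
    · simpa [h] using hη a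
  have h1 := kap_mul_lap hL hη' (hη c)
  rw [integral_altOrb_swap hL hη hθ, ← kap_mul_lap hL hη hθ,
    ← Finset.mul_prod_erase _ _ (Finset.mem_univ c),
    ← Finset.mul_prod_erase _ _ (Finset.mem_univ c), Function.update_self] at h1
  have h2 : ∏ a ∈ Finset.univ.erase c, (η c - Function.update η c θ a) =
      ∏ a ∈ Finset.univ.erase c, (η c - η a) :=
    Finset.prod_congr rfl fun a ha => by rw [Function.update_of_ne (Finset.ne_of_mem_erase ha)]
  rw [h2] at h1
  apply mul_left_cancel₀ (sub_ne_zero.2 hne)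
  linear_combination h1

/-- The product formula for the Laplace transform, up to a constant. -/
noncomputable def lapProd (L : Matrix (Fin p) (Fin p) ℂ →+ ℝ) (η : Fin p → ℂ) : ℂ :=
  vand η * ∏ a, kap L (η a)

lemma lapProd_update (η : Fin p → ℂ) (c : Fin p) (θ : ℂ) :
    lapProd L (Function.update η c θ) *
        (kap L (η c) * ∏ a ∈ Finset.univ.erase c, (η c - η a)) =
      lapProd L η * (kap L θ * ∏ a ∈ Finset.univ.erase c, (θ - η a)) := by
  have h := vand_update η c θ
  rw [lapProd, lapProd, ← Finset.mul_prod_erase _ _ (Finset.mem_univ c),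
    ← Finset.mul_prod_erase _ (fun a => kap L (η a)) (Finset.mem_univ c), Function.update_self,
    Finset.prod_congr rfl (fun a ha => by rw [Function.update_of_ne (Finset.ne_of_mem_erase ha)])]
  linear_combination (kap L θ * kap L (η c) * ∏ a ∈ Finset.univ.erase c, kap L (η a)) * h

lemma lap_mul_lapProd (hL : Continuous L) {η₀ η : Fin p → ℂ} (hη : ∀ a, 1 ≤ (η a).re)
    (hη₀ : ∀ a, 1 ≤ (η₀ a).re) (hinj : Function.Injective η₀) (hκ : ∀ a, kap L (η₀ a) ≠ 0)
    (hne : ∀ a b, η a ≠ η₀ b) :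
    lap L η * lapProd L η₀ = lap L η₀ * lapProd L η := by
  suffices ∀ S : Finset (Fin p), lap L (S.piecewise η η₀) * lapProd L η₀ =
      lap L η₀ * lapProd L (S.piecewise η η₀) by
    simpa using this Finset.univ
  intro S
  induction S using Finset.induction_on with
  | empty => simp
  | insert c S hc ih =>
    rw [Finset.piecewise_insert]
    set ζ := S.piecewise η η₀ with hζ
    have hζc : ζ c = η₀ c := by simp [hζ, hc]
    have hζre (a : Fin p) : 1 ≤ (ζ a).re := by
      by_cases ha : a ∈ S
      · simpa [hζ, ha] using hη a
      · simpa [hζ, ha] using hη₀ a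
    have h1 := kap_mul_lap_update hL hζre (hη c) c (by rw [hζc]; exact hne c c)
    have h2 := lapProd_update (L := L) ζ c (η c)
    have h3 : kap L (ζ c) * ∏ a ∈ Finset.univ.erase c, (ζ c - ζ a) ≠ 0 := by
      rw [hζc]
      refine mul_ne_zero (hκ c) (Finset.prod_ne_zero_iff.2 fun a ha => sub_ne_zero.2 ?_)
      have ha := Finset.ne_of_mem_erase ha
      by_cases haS : a ∈ S
      · simpa [hζ, haS] using (hne a c).symm
      · simpa [hζ, haS] using hinj.ne ha.symm
    apply mul_right_cancel₀ h3
    linear_combination (-lapProd L η₀) * h1 - lap L η₀ * h2 +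
      (kap L (η c) * ∏ a ∈ Finset.univ.erase c, (η c - ζ a)) * ih

lemma exists_lap_eq (hL : Continuous L) : ∃ C : ℂ, ∀ η : Fin p → ℂ, (∀ a, (η a).re = 1) →
    lap L η = C * lapProd L η := by
  obtain ⟨T, hT⟩ := (Filter.eventually_atTop.1 (eventually_kap_ne_zero hL))
  let x (a : Fin p) : ℝ := max T 2 + (a : ℕ)
  have hx (a : Fin p) : max T 2 ≤ x a := le_add_of_nonneg_right (Nat.cast_nonneg _)
  have hinj : Function.Injective fun a : Fin p => (x a : ℂ) := fun a b hab => by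
    simpa [x, Fin.val_inj] using hab
  have hκ (a : Fin p) : kap L (x a) ≠ 0 := hT _ ((le_max_left _ _).trans (hx a))
  have h2 (a : Fin p) : 2 ≤ x a := (le_max_right _ _).trans (hx a)
  have hD : lapProd L (fun a => (x a : ℂ)) ≠ 0 :=
    mul_ne_zero (det_vandermonde_ne_zero_iff.2 hinj) (Finset.prod_ne_zero_iff.2 fun a _ => hκ a)
  refine ⟨lap L (fun a => (x a : ℂ)) / lapProd L (fun a => (x a : ℂ)), fun η hη => ?_⟩
  have := lap_mul_lapProd hL (η := η) (η₀ := fun a => (x a : ℂ)) (fun a => (hη a).ge)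
    (fun a => by simpa using one_le_two.trans (h2 a)) hinj hκ (fun a b hab => by
      have h3 := congrArg Complex.re hab
      rw [hη, Complex.ofReal_re] at h3
      linarith [h2 b])
  rw [div_mul_eq_mul_div, eq_div_iff hD, this]

end

section
variable {p : ℕ} {L : Matrix (Fin p) (Fin p) ℂ →+ ℝ}

/-- The sign `+1` on the left summand and `-1` on the right summand. -/
def sgnSum {p : ℕ} {R : Type*} [Ring R] : Fin p ⊕ Fin p → R := Sum.elim (fun _ => 1) (fun _ => -1)

/-- The coefficient of a permutation in the alternating sums below. -/
def permCoeff {p : ℕ} (R : Type*) [CommRing R] (w : Equiv.Perm (Fin p ⊕ Fin p)) : R :=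
  (Equiv.Perm.sign w : ℤ) * ∏ j, sgnSum (w (Sum.inr j))

lemma sum_permCoeff_mul_det (Φ : Fin p ⊕ Fin p → Fin p → ℂ) :
    ∑ w : Equiv.Perm (Fin p ⊕ Fin p), permCoeff ℂ w *
        ((of fun a j => Φ (w (Sum.inl a)) j).det * (of fun a j => Φ (w (Sum.inr a)) j).det) =
      (p.factorial : ℂ) ^ 2 * (-2) ^ p *
        ((of fun a j => Φ (Sum.inl a) j).det * (of fun a j => Φ (Sum.inr a) j).det) := by
  set N : Matrix (Fin p ⊕ Fin p) (Fin p ⊕ Fin p) ℂ :=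
    of fun r => Sum.elim (fun j => Φ r j) (fun j => sgnSum r * Φ r j) with hN
  have hNdet : N.det = (-2) ^ p *
      ((of fun a j => Φ (Sum.inl a) j).det * (of fun a j => Φ (Sum.inr a) j).det) := by
    have h1 : N = fromBlocks (of fun a j => Φ (Sum.inl a) j) 0 0 (of fun a j => Φ (Sum.inr a) j) *
        fromBlocks 1 1 1 (-1) := by
      rw [fromBlocks_multiply]
      ext (i | i) (j | j) <;> simp [hN, sgnSum]
    have h2 : (-1 - 1 : Matrix (Fin p) (Fin p) ℂ) = (-2 : ℂ) • 1 := by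
      ext i j; simp; ring
    rw [h1, det_mul, det_fromBlocks_zero₁₂, det_fromBlocks_one₁₁, one_mul, h2, det_smul]
    simp
    ring
  let T (w : Equiv.Perm (Fin p ⊕ Fin p)) : ℂ := (Equiv.Perm.sign w : ℂ) * ∏ i, N (w i) i
  have h1 (w : Equiv.Perm (Fin p ⊕ Fin p)) : permCoeff ℂ w *
        ((of fun a j => Φ (w (Sum.inl a)) j).det * (of fun a j => Φ (w (Sum.inr a)) j).det) =
      ∑ σ : Equiv.Perm (Fin p), ∑ τ : Equiv.Perm (Fin p), T (w * Equiv.Perm.sumCongr σ τ) := by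
    rw [det_apply', det_apply', Finset.sum_mul_sum, Finset.mul_sum]
    refine Finset.sum_congr rfl fun σ _ => ?_
    rw [Finset.mul_sum]
    refine Finset.sum_congr rfl fun τ _ => ?_
    have h2 : ∏ j, (sgnSum (w (Sum.inr j)) : ℂ) = ∏ j, sgnSum (w (Sum.inr (τ j))) :=
      (Equiv.prod_comp τ fun j => sgnSum (w (Sum.inr j))).symm
    simp only [T, permCoeff, h2, Fintype.prod_sum_type, Equiv.Perm.mul_apply, hN, of_apply,
      Equiv.Perm.sumCongr_apply, Sum.map_inl, Sum.map_inr, Sum.elim_inl, Sum.elim_inr,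
      Equiv.Perm.sign_mul, Equiv.Perm.sign_sumCongr, Finset.prod_mul_distrib]
    push_cast
    ring
  simp_rw [h1]
  rw [Finset.sum_comm]
  simp_rw [Finset.sum_comm (s := Finset.univ (α := Equiv.Perm (Fin p ⊕ Fin p)))]
  have h3 (ρ : Equiv.Perm (Fin p ⊕ Fin p)) : ∑ w, T (w * ρ) = N.det := by
    rw [det_apply']
    exact Equiv.sum_comp (Equiv.mulRight ρ) T
  simp_rw [h3, hNdet]
  simp [Fintype.card_perm]
  ring

lemma lapProd_eq_det (η : Fin p → ℂ) :
    lapProd L η = (of fun a (j : Fin p) => kap L (η a) * η a ^ (j : ℕ)).det := by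
  rw [lapProd, vand, mul_comm, ← det_mul_column]
  rfl

lemma sum_permCoeff_mul_lapProd (η : Fin p ⊕ Fin p → ℂ) :
    ∑ w : Equiv.Perm (Fin p ⊕ Fin p), permCoeff ℂ w *
        (lapProd L (fun a => η (w (Sum.inl a))) * lapProd L (fun a => η (w (Sum.inr a)))) =
      (p.factorial : ℂ) ^ 2 * (-2) ^ p *
        (lapProd L (fun a => η (Sum.inl a)) * lapProd L (fun a => η (Sum.inr a))) := by
  simp_rw [lapProd_eq_det]
  exact sum_permCoeff_mul_det fun r j => kap L (η r) * η r ^ (j : ℕ)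

end

section
variable {p : ℕ} {L : Matrix (Fin p) (Fin p) ℂ →+ ℝ}

/-- The product of `altOrb` over the two halves of `z`. -/
noncomputable def altPair (L : Matrix (Fin p) (Fin p) ℂ →+ ℝ) (z : Fin p ⊕ Fin p → ℝ) : ℂ :=
  altOrb L (fun a => z (Sum.inl a)) * altOrb L (fun a => z (Sum.inr a))

lemma continuous_altPair (hL : Continuous L) : Continuous (altPair L) := by
  have := continuous_altOrb hL
  unfold altPair
  fun_prop

lemma altPair_mul_prod (z : Fin p ⊕ Fin p → ℝ) (h : Fin p ⊕ Fin p → ℝ → ℂ) :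
    altPair L z * ∏ i, h i (z i) =
      (fun u : (Fin p → ℝ) × (Fin p → ℝ) => (altOrb L u.1 * ∏ a, h (Sum.inl a) (u.1 a)) *
        (altOrb L u.2 * ∏ a, h (Sum.inr a) (u.2 a)))
        (MeasurableEquiv.sumPiEquivProdPi (fun _ : Fin p ⊕ Fin p => ℝ) z) := by
  rw [MeasurableEquiv.coe_sumPiEquivProdPi]
  simp only [altPair, Fintype.prod_sum_type, Equiv.sumPiEquivProdPi_apply]
  ring

lemma integrable_altPair_mul (hL : Continuous L) {h : Fin p ⊕ Fin p → ℝ → ℂ}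
    (hh : ∀ i, Decays (h i)) :
    Integrable fun z : Fin p ⊕ Fin p → ℝ => altPair L z * ∏ i, h i (z i) := by
  simp_rw [altPair_mul_prod]
  exact ((volume_measurePreserving_sumPiEquivProdPi
    (fun _ : Fin p ⊕ Fin p => ℝ)).integrable_comp_emb
    (MeasurableEquiv.measurableEmbedding _)).2
    ((integrable_altOrb_mul_prod hL fun a => hh (Sum.inl a)).mul_prod
      (integrable_altOrb_mul_prod hL fun a => hh (Sum.inr a)))

lemma integral_altPair_mul (η : Fin p ⊕ Fin p → ℂ) :
    ∫ z : Fin p ⊕ Fin p → ℝ, altPair L z * ∏ i, expo (η i) 0 (z i) =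
      lap L (fun a => η (Sum.inl a)) * lap L (fun a => η (Sum.inr a)) := by
  simp_rw [altPair_mul_prod]
  rw [(volume_measurePreserving_sumPiEquivProdPi (fun _ : Fin p ⊕ Fin p => ℝ)).integral_comp'
    (fun u : (Fin p → ℝ) × (Fin p → ℝ) =>
      (altOrb L u.1 * ∏ a, expo (η (Sum.inl a)) 0 (u.1 a)) *
        (altOrb L u.2 * ∏ a, expo (η (Sum.inr a)) 0 (u.2 a)))]
  rw [lap, lap, ← integral_prod_mul]
  rfl

lemma altPair_comp_perm_mul (w : Equiv.Perm (Fin p ⊕ Fin p)) (h : Fin p ⊕ Fin p → ℝ → ℂ)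
    (z : Fin p ⊕ Fin p → ℝ) :
    altPair L (z ∘ w) * ∏ i, h i (z i) =
      (fun z : Fin p ⊕ Fin p → ℝ => altPair L z * ∏ i, h (w i) (z i)) (z ∘ w) := by
  simp only [Function.comp_apply]
  rw [Equiv.prod_comp w (fun i => h i (z i))]

lemma integrable_altPair_comp_perm_mul (hL : Continuous L) (w : Equiv.Perm (Fin p ⊕ Fin p))
    {h : Fin p ⊕ Fin p → ℝ → ℂ} (hh : ∀ i, Decays (h i)) :
    Integrable fun z : Fin p ⊕ Fin p → ℝ => altPair L (z ∘ w) * ∏ i, h i (z i) := by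
  simp_rw [altPair_comp_perm_mul]
  exact integrable_comp_perm w (integrable_altPair_mul hL fun i => hh (w i))

/-- The defect in the permutation identity for `altPair`. -/
noncomputable def altDefect (L : Matrix (Fin p) (Fin p) ℂ →+ ℝ) (z : Fin p ⊕ Fin p → ℝ) : ℂ :=
  ∑ w : Equiv.Perm (Fin p ⊕ Fin p), permCoeff ℂ w * altPair L (z ∘ w) -
    (p.factorial : ℂ) ^ 2 * (-2) ^ p * altPair L z

lemma continuous_altDefect (hL : Continuous L) : Continuous (altDefect L) := by
  have := continuous_altPair hL
  unfold altDefect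
  fun_prop

lemma altDefect_mul (z : Fin p ⊕ Fin p → ℝ) (h : Fin p ⊕ Fin p → ℝ → ℂ) :
    altDefect L z * ∏ i, h i (z i) =
    ∑ w : Equiv.Perm (Fin p ⊕ Fin p), permCoeff ℂ w * (altPair L (z ∘ w) * ∏ i, h i (z i)) -
      (p.factorial : ℂ) ^ 2 * (-2) ^ p * (altPair L z * ∏ i, h i (z i)) := by
  rw [altDefect, sub_mul, Finset.sum_mul]
  simp_rw [mul_assoc]

lemma integrable_altDefect_mul (hL : Continuous L) {h : Fin p ⊕ Fin p → ℝ → ℂ}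
    (hh : ∀ i, Decays (h i)) :
    Integrable fun z : Fin p ⊕ Fin p → ℝ => altDefect L z * ∏ i, h i (z i) := by
  simp_rw [altDefect_mul]
  exact (integrable_finsetSum _ fun w _ =>
    (integrable_altPair_comp_perm_mul hL w hh).const_mul _).sub
      ((integrable_altPair_mul hL hh).const_mul _)

lemma integral_altDefect_mul (hL : Continuous L) {η : Fin p ⊕ Fin p → ℂ} (hη : ∀ i, (η i).re = 1) :
    ∫ z : Fin p ⊕ Fin p → ℝ, altDefect L z * ∏ i, expo (η i) 0 (z i) = 0 := by
  have hh (i : Fin p ⊕ Fin p) : Decays (expo (η i) 0) := decays_expo (hη i).ge le_rfl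
  obtain ⟨C, hC⟩ := exists_lap_eq hL
  have h1 (w : Equiv.Perm (Fin p ⊕ Fin p)) :
      ∫ z : Fin p ⊕ Fin p → ℝ, altPair L (z ∘ w) * ∏ i, expo (η i) 0 (z i) =
        C ^ 2 * (lapProd L (fun a => η (w (Sum.inl a))) *
          lapProd L (fun a => η (w (Sum.inr a)))) := by
    simp_rw [fun z => altPair_comp_perm_mul (L := L) w (fun i => expo (η i) 0) z]
    rw [integral_comp_perm w (fun z : Fin p ⊕ Fin p → ℝ =>
      altPair L z * ∏ i, expo (η (w i)) 0 (z i)), integral_altPair_mul (fun i => η (w i)),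
      hC _ fun a => hη _, hC _ fun a => hη _]
    ring
  have h2 := h1 1
  simp only [Equiv.Perm.coe_one, Function.comp_id, id_eq] at h2
  simp_rw [fun z => altDefect_mul (L := L) z fun i => expo (η i) 0]
  rw [integral_sub (integrable_finsetSum _ fun w _ =>
    (integrable_altPair_comp_perm_mul hL w hh).const_mul _)
      ((integrable_altPair_mul hL hh).const_mul _), integral_finsetSum _ fun w _ =>
    (integrable_altPair_comp_perm_mul hL w hh).const_mul _]
  simp_rw [integral_const_mul, h1, h2]
  have h3 := sum_permCoeff_mul_lapProd (L := L) η
  simp_rw [mul_left_comm _ (C ^ 2), ← Finset.mul_sum]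
  rw [h3]
  ring

open scoped FourierTransform

lemma altDefect_eq_zero (hL : Continuous L) {z : Fin p ⊕ Fin p → ℝ} (hz : ∀ i, 0 < z i) :
    altDefect L z = 0 := by
  let F (x : Fin p ⊕ Fin p → ℝ) : ℂ := altDefect L x * ∏ i, expo 1 0 (x i)
  let f (x : EuclideanSpace ℝ (Fin p ⊕ Fin p)) : ℂ := F (WithLp.ofLp x)
  have hf : Integrable f :=
    ((PiLp.volume_preserving_ofLp (Fin p ⊕ Fin p)).integrable_comp_emb
      (MeasurableEquiv.toLp 2 (Fin p ⊕ Fin p → ℝ)).symm.measurableEmbedding).2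
      (integrable_altDefect_mul hL fun _ => decays_expo (by simp) le_rfl)
  have h0 : 𝓕 f = 0 := by
    ext ξ
    rw [Real.fourier_eq', Pi.zero_apply,
      ← integral_altDefect_mul hL (η := fun i => 1 + 2 * Real.pi * ξ i * Complex.I) (by simp),
      ← (PiLp.volume_preserving_ofLp (Fin p ⊕ Fin p)).integral_comp
      (MeasurableEquiv.toLp 2 (Fin p ⊕ Fin p → ℝ)).symm.measurableEmbedding]
    congr 1
    ext x
    simp only [f, F, smul_eq_mul]
    rw [mul_left_comm]
    congr 1
    have h1 (i : Fin p ⊕ Fin p) : expo (1 + 2 * Real.pi * ξ i * Complex.I) 0 (x i) =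
        Complex.exp (-2 * Real.pi * (x i * ξ i) * Complex.I) * expo 1 0 (x i) := by
      rw [expo, expo, Set.indicator_apply, Set.indicator_apply]
      split_ifs
      · rw [← Complex.exp_add]
        congr 1; push_cast; ring
      · simp
    simp_rw [h1]
    rw [Finset.prod_mul_distrib, ← Complex.exp_sum]
    congr 2
    simp only [PiLp.inner_apply, Real.inner_apply, Complex.ofReal_mul, Complex.ofReal_sum,
      Finset.mul_sum, Finset.sum_mul]
    push_cast
    refine Finset.sum_congr rfl fun i _ => ?_
    ring
  have hopen : IsOpen {x : EuclideanSpace ℝ (Fin p ⊕ Fin p) | ∀ i, 0 < x i} := by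
    simp only [Set.ofPred_forall]
    exact isOpen_iInter_of_finite fun i => isOpen_lt continuous_const (by fun_prop)
  have hcont : ContinuousAt f (WithLp.toLp 2 z) := by
    have h1 : Continuous fun x : EuclideanSpace ℝ (Fin p ⊕ Fin p) => altDefect L (WithLp.ofLp x) *
        ∏ i, Complex.exp (-1 * (x i - (0 : ℝ))) := by
      have := continuous_altDefect hL
      refine (this.comp (PiLp.continuous_ofLp 2 _)).mul ?_
      fun_prop
    refine h1.continuousAt.congr ?_
    filter_upwards [hopen.mem_nhds (show WithLp.toLp 2 z ∈ _ from hz)] with x hx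
    simp only [f, F]
    congr 1
    refine Finset.prod_congr rfl fun i _ => ?_
    rw [expo, Set.indicator_of_mem (by exact hx i)]
  have h1 := hf.fourierInv_fourier_eq (by rw [h0]; exact integrable_zero _ _ _) hcont
  rw [h0] at h1
  have h2 : f (WithLp.toLp 2 z) = 0 := by
    rw [← h1, Real.fourierInv_eq]
    simp
  refine (mul_eq_zero.1 h2).resolve_right (Finset.prod_ne_zero_iff.2 fun i _ => ?_)
  rw [expo, Set.indicator_of_mem (by exact hz i)]
  exact Complex.exp_ne_zero _

end

section
variable {p : ℕ}

lemma vand_comp_finSumFinEquiv_symm (z : Fin p ⊕ Fin p → ℝ) :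
    vand (z ∘ finSumFinEquiv.symm) = vand (fun a => z (Sum.inl a)) * vand (fun a => z (Sum.inr a)) *
      ∏ j, ∏ k, (z (Sum.inr k) - z (Sum.inl j)) := by
  rw [vand_eq_prod_ite, ← Equiv.prod_comp finSumFinEquiv]
  simp_rw [← Equiv.prod_comp finSumFinEquiv (fun i => if _ < i then _ else _)]
  have h1 (j k : Fin p) : (finSumFinEquiv (Sum.inl j : Fin p ⊕ Fin p) : Fin (p + p)) <
      finSumFinEquiv (Sum.inr k) := by
    rw [Fin.lt_def]; simp; omega
  have h2 (j k : Fin p) : ¬ (finSumFinEquiv (Sum.inr j : Fin p ⊕ Fin p) : Fin (p + p)) <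
      finSumFinEquiv (Sum.inl k) := (h1 k j).not_gt
  have h3 (j k : Fin p) : (finSumFinEquiv (Sum.inl j : Fin p ⊕ Fin p) : Fin (p + p)) <
      finSumFinEquiv (Sum.inl k) ↔ j < k := by
    rw [Fin.lt_def]; simp
  have h4 (j k : Fin p) : (finSumFinEquiv (Sum.inr j : Fin p ⊕ Fin p) : Fin (p + p)) <
      finSumFinEquiv (Sum.inr k) ↔ j < k := by
    rw [Fin.lt_def]; simp
  simp only [Fintype.prod_sum_type, h1, h2, h3, h4, vand_eq_prod_ite, Finset.prod_mul_distrib,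
    Function.comp_apply, Equiv.symm_apply_apply, if_true, if_false, Finset.prod_const_one]
  ring

lemma vand_comp_perm_sum (z : Fin p ⊕ Fin p → ℝ) (w : Equiv.Perm (Fin p ⊕ Fin p)) :
    vand ((z ∘ w) ∘ finSumFinEquiv.symm) =
      Equiv.Perm.sign w * vand (z ∘ finSumFinEquiv.symm) := by
  have : (z ∘ w) ∘ finSumFinEquiv.symm =
      (z ∘ finSumFinEquiv.symm) ∘ (finSumFinEquiv.permCongr w) := by
    ext i; simp [Equiv.permCongr_apply]
  rw [this, vand_comp_perm, Equiv.Perm.sign_permCongr]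

/-- The sign relating the discriminant to the squared Vandermonde determinant. -/
def discSign (p : ℕ) : ℝ := ∏ k : Fin p, ∏ k' : Fin p, if k < k' then -1 else 1

lemma prod_ite_sub (y : Fin p → ℝ) :
    ∏ k, ∏ k', (if k' = k then 1 else y k - y k') = discSign p * vand y ^ 2 := by
  have h (k k' : Fin p) : (if k' = k then 1 else y k - y k') =
      (if k < k' then (-1 : ℝ) else 1) * (if k < k' then y k' - y k else 1) *
        (if k' < k then y k - y k' else 1) := by
    rcases lt_trichotomy k k' with h | rfl | h
    · simp [h, h.ne', h.not_gt]
    · simp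
    · simp [h, h.ne, h.not_gt]
  simp_rw [h, Finset.prod_mul_distrib]
  rw [Finset.prod_comm (f := fun k k' => if k' < k then y k - y k' else 1),
    ← vand_eq_prod_ite, discSign]
  ring

/-- Strict interlacing `z (inl 0) > z (inr 0) > z (inl 1) > ⋯`. -/
def Interlaced (z : Fin p ⊕ Fin p → ℝ) : Prop :=
  (∀ c, z (Sum.inr c) < z (Sum.inl c)) ∧ ∀ c d, c < d → z (Sum.inl d) < z (Sum.inr c)

lemma Interlaced.prod_pos {z : Fin p ⊕ Fin p → ℝ} (hz : Interlaced z) (b : Fin p ⊕ Fin p) :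
    0 < sgnSum b * ∏ i, (if i = b then 1 else z b - z i) := by
  have h1 := hz.1
  have h2 := hz.2
  rw [Fintype.prod_sum_type, ← Finset.prod_mul_distrib]
  obtain c | c := b
  · rw [sgnSum, Sum.elim_inl, one_mul]
    refine Finset.prod_pos fun j _ => ?_
    rcases lt_trichotomy c j with h | rfl | h
    · have h3 := h2 c j h
      have h4 := h1 c
      have h5 := h1 j
      simp only [Sum.inl.injEq, h.ne', if_false, reduceCtorEq]
      exact mul_pos (by linarith) (by linarith)
    · simpa using h1 c
    · have h3 := h2 j c h
      have h4 := h1 j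
      simp only [Sum.inl.injEq, h.ne, if_false, reduceCtorEq]
      exact mul_pos_of_neg_of_neg (by linarith) (by linarith)
  · rw [sgnSum, Sum.elim_inr, ← Finset.mul_prod_erase _ _ (Finset.mem_univ c), ← mul_assoc]
    refine mul_pos ?_ (Finset.prod_pos fun j hj => ?_)
    · simpa using h1 c
    · rcases lt_or_gt_of_ne (Finset.ne_of_mem_erase hj) with h | h
      · have h3 := h2 j c h
        have h4 := h1 j
        have h5 := h1 c
        simp only [Sum.inr.injEq, h.ne, if_false, reduceCtorEq]
        exact mul_pos_of_neg_of_neg (by linarith) (by linarith)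
      · have h3 := h2 c j h
        have h4 := h1 j
        simp only [Sum.inr.injEq, h.ne', if_false, reduceCtorEq]
        exact mul_pos (by linarith) (by linarith)

lemma Interlaced.injective {z : Fin p ⊕ Fin p → ℝ} (hz : Interlaced z) : Function.Injective z := by
  intro i b hib
  by_contra hne
  have h := hz.prod_pos b
  rw [Finset.prod_eq_zero (Finset.mem_univ i) (by simp [hne, hib]), mul_zero] at h
  exact h.false

lemma Interlaced.permCoeff_pos {z : Fin p ⊕ Fin p → ℝ} (hz : Interlaced z)
    (w : Equiv.Perm (Fin p ⊕ Fin p)) :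
    0 < discSign p * vand (z ∘ finSumFinEquiv.symm) * (permCoeff ℝ w *
      (vand (fun a => z (w (Sum.inl a))) * vand (fun a => z (w (Sum.inr a))))) := by
  have hinj := hz.injective.comp w.injective
  have hl : vand (fun a => z (w (Sum.inl a))) ≠ 0 :=
    vand_ne_zero_of_injective (hinj.comp Sum.inl_injective)
  have hr : vand (fun a => z (w (Sum.inr a))) ≠ 0 :=
    vand_ne_zero_of_injective (hinj.comp Sum.inr_injective)
  have h1 := vand_comp_perm_sum z w
  rw [vand_comp_finSumFinEquiv_symm] at h1
  simp only [Function.comp_apply] at h1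
  have h2 : 0 < ∏ k, (sgnSum (w (Sum.inr k)) *
      ∏ i, (if i = w (Sum.inr k) then 1 else z (w (Sum.inr k)) - z i)) :=
    Finset.prod_pos fun k _ => hz.prod_pos _
  simp_rw [← Equiv.prod_comp w (fun i => if i = w _ then 1 else z (w _) - z i),
    Fintype.prod_sum_type, w.injective.eq_iff, Sum.inr.injEq, reduceCtorEq, if_false,
    Finset.prod_mul_distrib] at h2
  rw [prod_ite_sub (fun k => z (w (Sum.inr k)))] at h2
  rw [Finset.prod_comm] at h1
  have h4 := mul_pos h2 (sq_pos_of_ne_zero hl)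
  refine h4.trans_eq ?_
  rw [permCoeff]
  linear_combination (discSign p * (∏ k, sgnSum (w (Sum.inr k))) *
    vand (fun a => z (w (Sum.inl a))) * vand (fun a => z (w (Sum.inr a)))) * h1

end

section
variable {p : ℕ}

instance : SecondCountableTopology (UGrp p) :=
  have : SecondCountableTopology (Matrix (Fin p) (Fin p) ℂ) :=
    inferInstanceAs (SecondCountableTopology (Fin p → Fin p → ℂ))
  Topology.IsEmbedding.subtypeVal.secondCountableTopology

/-- The sum of elements of the unitary orbits of `X` and `Y`. -/
noncomputable def orbSum (X Y : Matrix (Fin p) (Fin p) ℂ) (u : UGrp p × UGrp p) :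
    Fin p → Fin p → ℂ := cnj u.1 X + cnj u.2 Y

lemma continuous_orbSum (X Y : Matrix (Fin p) (Fin p) ℂ) : Continuous (orbSum X Y) :=
  (continuous_fst.cnj continuous_const).add (continuous_snd.cnj continuous_const)

/-- The distribution of the sum of independent random elements of two unitary orbits. -/
noncomputable def sumLaw (X Y : Matrix (Fin p) (Fin p) ℂ) : Measure (Fin p → Fin p → ℂ) :=
  ((haarU p).prod (haarU p)).map (orbSum X Y)

instance (X Y : Matrix (Fin p) (Fin p) ℂ) : IsProbabilityMeasure (sumLaw X Y) :=
  Measure.isProbabilityMeasure_map (continuous_orbSum X Y).measurable.aemeasurable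

/-- A real functional on arrays, as an additive functional on matrices. -/
noncomputable def dualMat (l : StrongDual ℝ (Fin p → Fin p → ℂ)) :
    Matrix (Fin p) (Fin p) ℂ →+ ℝ where
  toFun M := l M
  map_zero' := l.map_zero
  map_add' := l.map_add

lemma charFunDual_sumLaw (X Y : Matrix (Fin p) (Fin p) ℂ)
    (l : StrongDual ℝ (Fin p → Fin p → ℂ)) :
    charFunDual (sumLaw X Y) l = orb (dualMat l) X * orb (dualMat l) Y := by
  rw [charFunDual_apply, sumLaw, integral_map (continuous_orbSum X Y).measurable.aemeasurable
    (by fun_prop), orb, orb, ← integral_prod_mul]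
  congr 1
  ext u
  rw [← Complex.exp_add, ← add_mul, ← Complex.ofReal_add, ← map_add]
  rfl

lemma exists_cnj_add_cnj_eq {W : Type*} [Fintype W] {X Y : W → Matrix (Fin p) (Fin p) ℂ}
    {X₀ Y₀ : Matrix (Fin p) (Fin p) ℂ} {α : W → ℝ} {α₀ : ℝ} (hα : ∀ w, 0 < α w)
    (h : ∀ L : Matrix (Fin p) (Fin p) ℂ →+ ℝ, Continuous L →
      ∑ w, (α w : ℂ) * (orb L (X w) * orb L (Y w)) = α₀ * (orb L X₀ * orb L Y₀))
    (w : W) (U V : UGrp p) :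
    ∃ U' V' : UGrp p, cnj U' X₀ + cnj V' Y₀ = cnj U (X w) + cnj V (Y w) := by
  have hα₀ : 0 ≤ α₀ := by
    have h0 := h 0 continuous_const
    simp only [orb, AddMonoidHom.zero_apply, Complex.ofReal_zero, zero_mul, Complex.exp_zero,
      integral_const, probReal_univ, one_smul, mul_one] at h0
    rw [← Complex.ofReal_sum, Complex.ofReal_inj] at h0
    rw [← h0]
    exact Finset.sum_nonneg fun w _ => (hα w).le
  have hmeas : ∑ w, ENNReal.ofReal (α w) • sumLaw (X w) (Y w) =
      ENNReal.ofReal α₀ • sumLaw X₀ Y₀ := by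
    have hfin (w : W) : IsFiniteMeasure (ENNReal.ofReal (α w) • sumLaw (X w) (Y w)) :=
      Measure.smul_finite _ ENNReal.ofReal_ne_top
    have hfin₀ : IsFiniteMeasure (ENNReal.ofReal α₀ • sumLaw X₀ Y₀) :=
      Measure.smul_finite _ ENNReal.ofReal_ne_top
    refine Measure.ext_of_charFunDual ?_
    ext l
    have hint (ν : Measure (Fin p → Fin p → ℂ)) [IsFiniteMeasure ν] :
        Integrable (fun v => Complex.exp (l v * Complex.I)) ν :=
      (integrable_const (1 : ℝ)).mono' (by fun_prop)
        (.of_forall fun v => (Complex.norm_exp_ofReal_mul_I _).le)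
    rw [charFunDual_apply, charFunDual_apply, integral_finsetSum_measure fun w _ => hint _,
      integral_smul_measure, ENNReal.toReal_ofReal hα₀, ← charFunDual_apply, charFunDual_sumLaw,
      Complex.real_smul]
    rw [← h (dualMat l) l.continuous]
    refine Finset.sum_congr rfl fun w _ => ?_
    rw [integral_smul_measure, ENNReal.toReal_ofReal (hα w).le, ← charFunDual_apply,
      charFunDual_sumLaw, Complex.real_smul]
  by_contra hne
  set T := Set.range (orbSum X₀ Y₀) with hT
  have hTc : IsClosed T := (isCompact_range (continuous_orbSum X₀ Y₀)).isClosed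
  have h1 : (sumLaw X₀ Y₀) Tᶜ = 0 := by
    rw [sumLaw, Measure.map_apply (continuous_orbSum X₀ Y₀).measurable
      hTc.isOpen_compl.measurableSet]
    have : orbSum X₀ Y₀ ⁻¹' Tᶜ = ∅ := by
      ext u; simp [hT]
    rw [this, measure_empty]
  have h2 : (∑ w, ENNReal.ofReal (α w) • sumLaw (X w) (Y w)) Tᶜ = 0 := by
    rw [hmeas, Measure.smul_apply, h1, smul_zero]
  rw [Measure.finsetSum_apply, Finset.sum_eq_zero_iff] at h2
  have h3 := h2 w (Finset.mem_univ w)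
  rw [Measure.smul_apply, smul_eq_mul, mul_eq_zero] at h3
  have h4 := h3.resolve_left (by simpa using hα w)
  rw [sumLaw, Measure.map_apply (continuous_orbSum _ _).measurable
    hTc.isOpen_compl.measurableSet] at h4
  refine (hTc.isOpen_compl.preimage (continuous_orbSum (X w) (Y w))).measure_ne_zero
    ((haarU p).prod (haarU p)) ⟨(U, V), ?_⟩ h4
  rintro ⟨u, hu⟩
  exact hne ⟨u.1, u.2, hu⟩

/-- The part of `z` on the first half after permuting by `w`. -/
noncomputable def diagL (z : Fin p ⊕ Fin p → ℝ) (w : Equiv.Perm (Fin p ⊕ Fin p)) :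
    Matrix (Fin p) (Fin p) ℂ := rdiag fun a => z (w (Sum.inl a))

/-- The part of `z` on the second half after permuting by `w`. -/
noncomputable def diagR (z : Fin p ⊕ Fin p → ℝ) (w : Equiv.Perm (Fin p ⊕ Fin p)) :
    Matrix (Fin p) (Fin p) ℂ := rdiag fun a => z (w (Sum.inr a))

lemma Interlaced.exists_cnj_of_pos {z : Fin p ⊕ Fin p → ℝ} (hz : Interlaced z)
    (hpos : ∀ i, 0 < z i) (w : Equiv.Perm (Fin p ⊕ Fin p)) (U V : UGrp p) :
    ∃ U' V' : UGrp p, cnj U' (diagL z 1) + cnj V' (diagR z 1) =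
      cnj U (diagL z w) + cnj V (diagR z w) := by
  set s := discSign p * vand (z ∘ finSumFinEquiv.symm) with hs
  refine exists_cnj_add_cnj_eq (X := diagL z) (Y := diagR z) (α := fun w => s * (permCoeff ℝ w *
      (vand (fun a => z (w (Sum.inl a))) * vand (fun a => z (w (Sum.inr a))))))
    (α₀ := s * ((p.factorial : ℝ) ^ 2 * (-2) ^ p *
      (vand (fun a => z (Sum.inl a)) * vand (fun a => z (Sum.inr a)))))
    (fun w => hz.permCoeff_pos w) (fun L hL => ?_) w U V
  have h := altDefect_eq_zero hL hpos
  rw [altDefect, sub_eq_zero] at h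
  have hc (w : Equiv.Perm (Fin p ⊕ Fin p)) : ((permCoeff ℝ w : ℝ) : ℂ) = permCoeff ℂ w := by
    have h1 (i : Fin p ⊕ Fin p) : ((sgnSum i : ℝ) : ℂ) = sgnSum i := by
      obtain i | i := i <;> simp [sgnSum]
    simp [permCoeff, h1]
  have h2 := congrArg (fun x => (s : ℂ) * x) h
  simp only [Finset.mul_sum] at h2
  push_cast
  simp only [altPair, altOrb, Function.comp_apply] at h2
  simp only [hc, diagL, diagR, Equiv.Perm.coe_one, id_eq]
  convert h2 using 1
  · refine Finset.sum_congr rfl fun w _ => ?_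
    ring
  · ring

lemma cnj_add (U : UGrp p) (X Y : Matrix (Fin p) (Fin p) ℂ) :
    cnj U (X + Y) = cnj U X + cnj U Y := by
  simp [cnj, Matrix.mul_add, Matrix.add_mul]

lemma cnj_smul_one (U : UGrp p) (c : ℂ) : cnj U (c • 1) = c • 1 := by
  have := Unitary.star_mul_self_of_mem U.2
  simp [cnj, this]

lemma rdiag_add_const (y : Fin p → ℝ) (c : ℝ) :
    rdiag (fun a => y a + c) = rdiag y + (c : ℂ) • 1 := by
  ext i j
  rcases eq_or_ne i j with rfl | h
  · simp [rdiag]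
  · simp [rdiag, h]

lemma Interlaced.exists_cnj {z : Fin p ⊕ Fin p → ℝ} (hz : Interlaced z)
    (w : Equiv.Perm (Fin p ⊕ Fin p)) (U V : UGrp p) :
    ∃ U' V' : UGrp p, cnj U' (diagL z 1) + cnj V' (diagR z 1) =
      cnj U (diagL z w) + cnj V (diagR z w) := by
  let c : ℝ := 1 + ∑ i, |z i|
  have hz' : Interlaced fun i => z i + c :=
    ⟨fun a => by simpa using hz.1 a, fun a b hab => by simpa using hz.2 a b hab⟩
  have hpos (i : Fin p ⊕ Fin p) : 0 < z i + c := by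
    have h1 := Finset.single_le_sum (fun i _ => abs_nonneg (z i)) (Finset.mem_univ i)
    have h2 := neg_abs_le (z i)
    simp only [c]
    linarith
  obtain ⟨U', V', h⟩ := hz'.exists_cnj_of_pos hpos w U V
  refine ⟨U', V', ?_⟩
  simp only [diagL, diagR, rdiag_add_const, cnj_add, cnj_smul_one] at h ⊢
  rw [add_add_add_comm, add_add_add_comm (cnj U _)] at h
  exact add_right_cancel h

/-- The spectral exchange theorem for weakly interlaced lists. -/
lemma exists_cnj_of_weakly_interlaced {z : Fin p ⊕ Fin p → ℝ}
    (hz₁ : ∀ c, z (Sum.inr c) ≤ z (Sum.inl c)) (hz₂ : ∀ c d, c < d → z (Sum.inl d) ≤ z (Sum.inr c))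
    (w : Equiv.Perm (Fin p ⊕ Fin p)) (U V : UGrp p) :
    ∃ U' V' : UGrp p, cnj U' (diagL z 1) + cnj V' (diagR z 1) =
      cnj U (diagL z w) + cnj V (diagR z w) := by
  let ρ : Fin p ⊕ Fin p → ℝ := Sum.elim (fun c => -2 * (c : ℕ)) (fun c => -2 * (c : ℕ) - 1)
  let zt (t : ℝ) (i : Fin p ⊕ Fin p) : ℝ := z i + t * ρ i
  have hzt {t : ℝ} (ht : 0 < t) : Interlaced (zt t) := by
    refine ⟨fun c => ?_, fun c d hcd => ?_⟩
    · have := hz₁ c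
      simp only [zt, ρ, Sum.elim_inl, Sum.elim_inr]
      linarith
    · have h1 := hz₂ c d hcd
      have h2 : ((c : ℕ) : ℝ) + 1 ≤ (d : ℕ) := by exact_mod_cast hcd
      simp only [zt, ρ, Sum.elim_inl, Sum.elim_inr]
      nlinarith
  have hL (w : Equiv.Perm (Fin p ⊕ Fin p)) : Continuous fun t => diagL (zt t) w :=
    continuous_rdiag.comp (by fun_prop)
  have hR (w : Equiv.Perm (Fin p ⊕ Fin p)) : Continuous fun t => diagR (zt t) w :=
    continuous_rdiag.comp (by fun_prop)
  let K : Set ((UGrp p × UGrp p) × ℝ) := {x | cnj x.1.1 (diagL (zt x.2) 1) +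
    cnj x.1.2 (diagR (zt x.2) 1) = cnj U (diagL (zt x.2) w) + cnj V (diagR (zt x.2) w)}
  have hK : IsClosed K := by
    refine isClosed_eq ?_ ?_
    · exact ((continuous_fst.comp continuous_fst).cnj ((hL 1).comp continuous_snd)).add
        ((continuous_snd.comp continuous_fst).cnj ((hR 1).comp continuous_snd))
    · exact (continuous_const.cnj ((hL w).comp continuous_snd)).add
        (continuous_const.cnj ((hR w).comp continuous_snd))
  have hS : IsClosed (Prod.snd '' K) := isClosedMap_snd_of_compactSpace _ hK
  have hsub : Set.Ioi (0 : ℝ) ⊆ Prod.snd '' K := fun t ht => by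
    obtain ⟨U', V', h⟩ := (hzt ht).exists_cnj w U V
    exact ⟨((U', V'), t), h, rfl⟩
  have h0 : (0 : ℝ) ∈ Prod.snd '' K := by
    apply hS.closure_subset_iff.2 hsub
    rw [closure_Ioi]
    exact Set.self_mem_Ici
  obtain ⟨⟨⟨U', V'⟩, t⟩, hx, rfl⟩ := h0
  refine ⟨U', V', ?_⟩
  simpa [K, zt] using hx

end

lemma HasEigs.charpoly_eq {ι : Type} [Fintype ι] [DecidableEq ι] {M : Matrix ι ι ℂ} {μ : ι → ℝ}
    (h : HasEigs M μ) : M.charpoly = ∏ i, (Polynomial.X - Polynomial.C (μ i : ℂ)) := by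
  obtain ⟨U, -, h, rfl⟩ := h
  rw [Matrix.charpoly_mul_comm, ← Matrix.mul_assoc, h, one_mul, charpoly_diagonal]

lemma hasEigs_cnj {p : ℕ} (U : UGrp p) (y : Fin p → ℝ) : HasEigs (cnj U (rdiag y)) y := by
  refine ⟨star U, ?_, ?_, ?_⟩ <;>
    rw [← star_eq_conjTranspose, star_star]
  · exact Unitary.star_mul_self_of_mem U.2
  · exact Unitary.mul_star_self_of_mem U.2
  · rfl

lemma prod_odd_even {M : Type*} [CommMonoid M] (p : ℕ) (F : ℕ → M) :
    ∏ i : Fin p ⊕ Fin p, F ((finSumFinEquiv i : ℕ) + 1) =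
      (∏ i : Fin p, F (2 * (i : ℕ) + 1)) * ∏ i : Fin p, F (2 * (i : ℕ) + 2) := by
  rw [Equiv.prod_comp finSumFinEquiv fun i : Fin (p + p) => F ((i : ℕ) + 1),
    Fin.prod_univ_eq_prod_range (fun i => F (i + 1)),
    Fin.prod_univ_eq_prod_range fun i => F (2 * i + 1),
    Fin.prod_univ_eq_prod_range fun i => F (2 * i + 2)]
  induction p with
  | zero => simp
  | succ p ih =>
    rw [Finset.prod_range_succ (fun i => F (2 * i + 1)),
      Finset.prod_range_succ (fun i => F (2 * i + 2)),
      mul_mul_mul_comm, ← ih, show p + 1 + (p + 1) = p + p + 1 + 1 by ring, Finset.prod_range_succ,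
      Finset.prod_range_succ, mul_assoc, two_mul]

end

theorem stmt12 (p : ℕ) (hp : 0 < p) (A B : Matrix (Fin p) (Fin p) ℂ) (γ : ℕ → ℝ)
    (hA : A.IsHermitian) (hB : B.IsHermitian)
    (hγmono : ∀ a b, 1 ≤ a → a ≤ b → b ≤ 2 * p → γ b ≤ γ a)
    (hcomb : HasEigs (Matrix.fromBlocks A 0 0 B) (fun i => γ ((finSumFinEquiv i : ℕ) + 1))) :
    ∃ A' B' : Matrix (Fin p) (Fin p) ℂ,
      HasEigs A' (fun i => γ (2 * (i : ℕ) + 1)) ∧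
      HasEigs B' (fun i => γ (2 * (i : ℕ) + 2)) ∧
      A' + B' = A + B := by
  set z : Fin p ⊕ Fin p → ℝ :=
    Sum.elim (fun i => γ (2 * (i : ℕ) + 1)) (fun i => γ (2 * (i : ℕ) + 2)) with hz
  have h₁ (c : Fin p) : z (Sum.inr c) ≤ z (Sum.inl c) :=
    hγmono _ _ (by omega) (by omega) (by omega)
  have h₂ (c d : Fin p) (hcd : c < d) : z (Sum.inl d) ≤ z (Sum.inr c) :=
    hγmono _ _ (by omega) (by omega) (by omega)
  obtain ⟨w, hw⟩ : ∃ w : Equiv.Perm (Fin p ⊕ Fin p),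
      Sum.elim hA.eigenvalues hB.eigenvalues = z ∘ w := by
    refine exists_perm_of_prod_X_sub_C_eq ?_
    have h := hcomb.charpoly_eq
    rw [Matrix.charpoly_fromBlocks_zero₁₂, hA.charpoly_eq, hB.charpoly_eq,
      prod_odd_even p fun n => Polynomial.X - Polynomial.C (γ n : ℂ)] at h
    simpa [Fintype.prod_sum_type, hz] using h
  have hwA : rdiag hA.eigenvalues = diagL z w :=
    congrArg rdiag (funext fun a => congrFun hw (Sum.inl a))
  have hwB : rdiag hB.eigenvalues = diagR z w :=
    congrArg rdiag (funext fun a => congrFun hw (Sum.inr a))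
  obtain ⟨U, hU⟩ := exists_cnj_of_charpoly (y := hA.eigenvalues) hA hA.charpoly_eq
  obtain ⟨V, hV⟩ := exists_cnj_of_charpoly (y := hB.eigenvalues) hB hB.charpoly_eq
  obtain ⟨U', V', h⟩ := exists_cnj_of_weakly_interlaced h₁ h₂ w U V
  refine ⟨_, _, hasEigs_cnj U' _, hasEigs_cnj V' _, ?_⟩
  rw [hU, hV, hwA, hwB]
  exact h
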